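/- Let X be a spectrally negative Lévy process with paths of bounded variation, let q ≥ 0, b > 0 and let Y be a nonnegative random variable independent of X. Then 𝔼[ e^{−q τ_0^−} 1_{τ_0^− < τ_b^+, X_{τ_0^−} > −Y} · W^{(q)}(X_{τ_0^−} + Y) / W^{(q)}(Y) ] = W^{(q)}(0+) · 𝔼[∫_0^b H^{(q)}(b,y) ∫_{(−y−Y,−y)} (W^{(q)}(y+x+Y)/W^{(q)}(Y)) Π(dx) dy]. -/

import Mathlib

open MeasureTheory ProbabilityTheory Set Filter
open scoped ENNReal

noncomputable section

/-- A spectrally negative Lévy process: a family of laws `P x` (the process started at `x`),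
the process `X`, its left limits `Xlim`, Laplace exponent `ψ`, right inverse `Φ`,
Gaussian coefficient `σ2`, Lévy measure `levyMeasure`, and the scale functions `W` together
with (a version of) their derivatives/densities `W'`. -/
structure SNLevy (Ω : Type) [MeasurableSpace Ω] where
  P : ℝ → Measure Ω
  probP : ∀ x, IsProbabilityMeasure (P x)
  X : ℝ → Ω → ℝ
  measX : ∀ t : ℝ, Measurable (X t)
  start : ∀ x : ℝ, ∀ᵐ ω ∂ P x, X 0 ω = x
  rightCont : ∀ x : ℝ, ∀ᵐ ω ∂ P x, ∀ t : ℝ, 0 ≤ t →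
      Filter.Tendsto (fun s => X s ω) (nhdsWithin t (Set.Ioi t)) (nhds (X t ω))
  Xlim : ℝ → Ω → ℝ
  leftLimit : ∀ x : ℝ, ∀ᵐ ω ∂ P x, ∀ t : ℝ, 0 < t →
      Filter.Tendsto (fun s => X s ω) (nhdsWithin t (Set.Iio t)) (nhds (Xlim t ω))
  spatialHom : ∀ x t : ℝ, 0 ≤ t → (P x).map (X t) = (P 0).map (fun ω => x + X t ω)
  stationaryInc : ∀ x s t : ℝ, 0 ≤ s → 0 ≤ t →
      (P x).map (fun ω => X (s + t) ω - X s ω) = (P 0).map (X t)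
  indepInc : ∀ x s t : ℝ, 0 ≤ s → 0 ≤ t →
      ProbabilityTheory.Indep
        (MeasurableSpace.comap (fun ω => X (s + t) ω - X s ω) inferInstance)
        (⨆ u ∈ Set.Icc (0 : ℝ) s, MeasurableSpace.comap (X u) inferInstance) (P x)
  noPosJumps : ∀ x : ℝ, ∀ᵐ ω ∂ P x, ∀ t : ℝ, 0 < t → X t ω ≤ Xlim t ω
  notNegSubordinator : ¬ (∀ᵐ ω ∂ P 0, ∀ s t : ℝ, 0 ≤ s → s ≤ t → X t ω ≤ X s ω)
  ψ : ℝ → ℝ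
  laplaceExp : ∀ lam : ℝ, 0 ≤ lam → ∀ t : ℝ, 0 ≤ t →
      ∫ ω, Real.exp (lam * X t ω) ∂ P 0 = Real.exp (ψ lam * t)
  Φ : ℝ → ℝ
  Φdef : ∀ θ : ℝ, 0 ≤ θ → Φ θ = sSup {lam : ℝ | 0 ≤ lam ∧ ψ lam = θ}
  γ : ℝ
  σ2 : ℝ
  σ2nonneg : 0 ≤ σ2
  levyMeasure : Measure ℝ
  levySupp : levyMeasure (Set.Ici 0) = 0
  levyInt : ∫⁻ y, ENNReal.ofReal (min 1 (y ^ 2)) ∂levyMeasure ≠ ∞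
  levyKhintchine : ∀ lam : ℝ, 0 ≤ lam →
      ψ lam = γ * lam + σ2 / 2 * lam ^ 2 +
        ∫ y, (Real.exp (lam * y) - 1 - lam * y * (if -1 < y then 1 else 0)) ∂levyMeasure
  W : ℝ → ℝ → ℝ
  Wnonneg : ∀ θ : ℝ, 0 ≤ θ → ∀ y : ℝ, 0 ≤ W θ y
  Wzero : ∀ θ : ℝ, 0 ≤ θ → ∀ y : ℝ, y < 0 → W θ y = 0
  Wcont : ∀ θ : ℝ, 0 ≤ θ → ContinuousOn (W θ) (Set.Ioi 0)
  Wmeas : ∀ θ : ℝ, 0 ≤ θ → Measurable (W θ)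
  Wlaplace : ∀ θ : ℝ, 0 ≤ θ → ∀ lam : ℝ, Φ θ < lam →
      ∫ y in Set.Ioi (0 : ℝ), Real.exp (-lam * y) * W θ y = 1 / (ψ lam - θ)
  Wuniq : ∀ θ : ℝ, 0 ≤ θ → ∀ V : ℝ → ℝ, ContinuousOn V (Set.Ioi 0) →
      (∀ lam : ℝ, Φ θ < lam →
        ∫ y in Set.Ioi (0 : ℝ), Real.exp (-lam * y) * V y = 1 / (ψ lam - θ)) →
      Set.EqOn V (W θ) (Set.Ioi 0)
  W' : ℝ → ℝ → ℝ
  Wabscont : ∀ θ : ℝ, 0 ≤ θ → ∀ y : ℝ, 0 ≤ y →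
      W θ y = W θ 0 + ∫ z in Set.Ioc (0 : ℝ) y, W' θ z

namespace SNLevy

variable {Ω : Type} [MeasurableSpace Ω] (L : SNLevy Ω)

/-- First passage time above level `a`: `τ_a^+ = inf {t > 0 : X_t > a}`, valued in `ℝ≥0∞`
(`⊤` when the level is never passed). -/
def tauAbove (a : ℝ) (ω : Ω) : ℝ≥0∞ :=
  sInf {t : ℝ≥0∞ | t ≠ ⊤ ∧ 0 < t ∧ a < L.X t.toReal ω}

/-- First passage time below level `a`: `τ_a^- = inf {t > 0 : X_t < a}`. -/
def tauBelow (a : ℝ) (ω : Ω) : ℝ≥0∞ :=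
  sInf {t : ℝ≥0∞ | t ≠ ⊤ ∧ 0 < t ∧ L.X t.toReal ω < a}

/-- `𝒲^{(θ)}(a,x,y) = W^{(θ)}(x) W^{(θ)}(a-y)/W^{(θ)}(a) - W^{(θ)}(x-y)`. -/
def scrW (θ a x y : ℝ) : ℝ :=
  L.W θ x * L.W θ (a - y) / L.W θ a - L.W θ (x - y)

/-- `𝒪^{(θ)}(a,x) = W^{(θ)'}(x) - W^{(θ)}(x) W^{(θ)'}(a)/W^{(θ)}(a)`. -/
def scrO (θ a x : ℝ) : ℝ :=
  L.W' θ x - L.W θ x * L.W' θ a / L.W θ a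

/-- `H^{(θ)}(b,x) = W^{(θ)}(b-x)/W^{(θ)}(b) - e^{Φ(θ)b} W^{(θ)}(-x)/W^{(θ)}(b)`. -/
def H (θ b x : ℝ) : ℝ :=
  L.W θ (b - x) / L.W θ b - Real.exp (L.Φ θ * b) * L.W θ (-x) / L.W θ b

end SNLevy

/-- `e^{-q t} 1_{t < ∞}` for an extended-real time `t`. -/
def eNeg (q : ℝ) (t : ℝ≥0∞) : ℝ :=
  if t = ⊤ then 0 else Real.exp (-q * t.toReal)


theorem laplace_unique (ν₁ ν₂ : Measure ℝ) (l₀ : ℝ)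
    (h : ∀ l, l₀ < l → ∫⁻ x, ENNReal.ofReal (Real.exp (l * x)) ∂ν₁
      = ∫⁻ x, ENNReal.ofReal (Real.exp (l * x)) ∂ν₂)
    (hfin : ∀ l, l₀ < l → ∫⁻ x, ENNReal.ofReal (Real.exp (l * x)) ∂ν₁ ≠ ⊤) : ν₁ = ν₂ := by
  set d : ℝ → ℝ≥0∞ := fun x => ENNReal.ofReal (Real.exp ((l₀ + 2) * x)) with hd
  have hdm : Measurable d := by fun_prop
  have tilt : ∀ ν : Measure ℝ, ∀ t : ℝ,
      ∫⁻ x, ENNReal.ofReal (Real.exp (t * x)) ∂(ν.withDensity d)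
        = ∫⁻ x, ENNReal.ofReal (Real.exp ((l₀ + 2 + t) * x)) ∂ν := by
    intro ν t
    rw [lintegral_withDensity_eq_lintegral_mul _ hdm (by fun_prop)]
    refine lintegral_congr fun x => ?_
    simp only [hd, Pi.mul_apply]
    rw [← ENNReal.ofReal_mul (Real.exp_pos _).le, ← Real.exp_add]
    ring_nf
  have hint : ∀ ν : Measure ℝ, (∀ l, l₀ < l → ∫⁻ x, ENNReal.ofReal (Real.exp (l * x)) ∂ν ≠ ⊤) →
      ∀ t : ℝ, -2 < t → Integrable (fun x => Real.exp (t * x)) (ν.withDensity d) := by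
    intro ν hν t ht
    refine ⟨by fun_prop, ?_⟩
    rw [hasFiniteIntegral_iff_ofReal (ae_of_all _ fun x => (Real.exp_pos _).le), tilt]
    exact (hν _ (by linarith)).lt_top
  have hfin2 : ∀ l, l₀ < l → ∫⁻ x, ENNReal.ofReal (Real.exp (l * x)) ∂ν₂ ≠ ⊤ :=
    fun l hl => h l hl ▸ hfin l hl
  have hf : ∀ ν : Measure ℝ, (∀ l, l₀ < l → ∫⁻ x, ENNReal.ofReal (Real.exp (l * x)) ∂ν ≠ ⊤) →
      IsFiniteMeasure (ν.withDensity d) := by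
    intro ν hν
    refine isFiniteMeasure_withDensity (hν _ (by linarith))
  have := hf ν₁ hfin
  have := hf ν₂ hfin2
  have hsub : ∀ ν : Measure ℝ, (∀ l, l₀ < l → ∫⁻ x, ENNReal.ofReal (Real.exp (l * x)) ∂ν ≠ ⊤) →
      {z : ℂ | z.re ∈ Ioi (-2 : ℝ)} ⊆ {z | z.re ∈ interior (integrableExpSet id (ν.withDensity d))} := by
    intro ν hν z hz
    refine interior_mono (s := Ioi (-2 : ℝ)) (fun t ht => ?_) (by rw [interior_Ioi]; exact hz)
    exact hint ν hν t ht
  have hmgf : ∀ t : ℝ, -2 < t → mgf id (ν₁.withDensity d) t = mgf id (ν₂.withDensity d) t := by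
    intro t ht
    simp only [mgf, id]
    rw [integral_eq_lintegral_of_nonneg_ae (ae_of_all _ fun x => (Real.exp_pos _).le) (by fun_prop),
      integral_eq_lintegral_of_nonneg_ae (ae_of_all _ fun x => (Real.exp_pos _).le) (by fun_prop),
      tilt, tilt, h _ (by linarith)]
  have hE : EqOn (complexMGF id (ν₁.withDensity d)) (complexMGF id (ν₂.withDensity d))
      {z : ℂ | z.re ∈ Ioi (-2 : ℝ)} := by
    refine AnalyticOnNhd.eqOn_of_preconnected_of_frequently_eq
      (analyticOnNhd_complexMGF.mono (hsub _ hfin)) (analyticOnNhd_complexMGF.mono (hsub _ hfin2))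
      ((convex_Ioi (-2 : ℝ)).linear_preimage Complex.reLm).isPreconnected
      (z₀ := ((0 : ℝ) : ℂ)) (by simp) ?_
    have hreal : ∃ᶠ x : ℝ in nhdsWithin 0 {0}ᶜ,
        complexMGF id (ν₁.withDensity d) x = complexMGF id (ν₂.withDensity d) x := by
      refine Filter.Eventually.frequently ?_
      have : ∀ᶠ x : ℝ in nhds 0, -2 < x := lt_mem_nhds (by norm_num)
      filter_upwards [this.filter_mono nhdsWithin_le_nhds] with x hx
      rw [complexMGF_ofReal, complexMGF_ofReal, hmgf x hx]
    rw [frequently_iff_seq_forall] at hreal ⊢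
    obtain ⟨xs, hx_tendsto, hx_eq⟩ := hreal
    refine ⟨fun n => xs n, ?_, fun n => ?_⟩
    · rw [tendsto_nhdsWithin_iff] at hx_tendsto ⊢
      constructor
      · exact (Complex.continuous_ofReal.tendsto 0).comp hx_tendsto.1
      · simpa using hx_tendsto.2
    · exact hx_eq n
  have hmu : ν₁.withDensity d = ν₂.withDensity d := by
    apply Measure.ext_of_charFun
    ext t
    rw [← complexMGF_id_mul_I, ← complexMGF_id_mul_I]
    exact hE (by simp)
  have back : ∀ ν : Measure ℝ, ν = (ν.withDensity d).withDensity (fun x => (d x)⁻¹) := by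
    intro ν
    rw [← withDensity_mul _ hdm (by exact hdm.inv)]
    have : (d * fun x => (d x)⁻¹) = 1 := by
      ext x
      simp only [Pi.mul_apply, Pi.one_apply, hd]
      exact ENNReal.mul_inv_cancel (by simp [Real.exp_pos]) (by simp)
    rw [this, withDensity_one]
  rw [back ν₁, back ν₂, hmu]

/-- convergence of expectations under a uniform `L²` bound -/
theorem tendsto_integral_of_sq_bound {Ω : Type*} [MeasurableSpace Ω] (P : Measure Ω)
    [IsProbabilityMeasure P] (Z : ℕ → Ω → ℝ) (Z' : Ω → ℝ) (B D : ℝ)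
    (hi : ∀ n, Integrable (Z n) P) (hi2 : ∀ n, Integrable (fun ω => Z n ω ^ 2) P)
    (hb : ∀ n, ∫ ω, Z n ω ^ 2 ∂P ≤ B) (h0 : ∀ n ω, 0 ≤ Z n ω)
    (hD : ∀ᵐ ω ∂P, Z' ω ≤ D)
    (hlim : ∀ᵐ ω ∂P, Tendsto (fun n => Z n ω) atTop (nhds (Z' ω))) :
    Tendsto (fun n => ∫ ω, Z n ω ∂P) atTop (nhds (∫ ω, Z' ω ∂P)) := by
  have hB : 0 ≤ B := le_trans (integral_nonneg fun ω => sq_nonneg _) (hb 0)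
  have hmini : ∀ (C : ℝ) n, Integrable (fun ω => min (Z n ω) C) P := fun C n =>
    (hi n).inf (integrable_const C)
  rw [Metric.tendsto_atTop]
  intro ε hε
  set C : ℝ := max (max D 1) (B / ε) with hC
  have hC1 : 1 ≤ C := le_trans (le_max_right _ _) (le_max_left _ _)
  have hCD : D ≤ C := le_trans (le_max_left _ _) (le_max_left _ _)
  have hCB : B / ε ≤ C := le_max_right _ _
  have hlimC : Tendsto (fun n => ∫ ω, min (Z n ω) C ∂P) atTop (nhds (∫ ω, Z' ω ∂P)) := by
    refine tendsto_integral_of_dominated_convergence (fun _ => C) (fun n => (hmini C n).1)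
      (integrable_const C) (fun n => ae_of_all _ fun ω => ?_) ?_
    · rw [Real.norm_eq_abs, abs_of_nonneg (le_min (h0 n ω) (by linarith))]
      exact min_le_right _ _
    · filter_upwards [hD, hlim] with ω h1 h2
      have := h2.min (tendsto_const_nhds (x := C))
      rwa [min_eq_left (h1.trans hCD)] at this
  obtain ⟨N, hN⟩ := (Metric.tendsto_atTop.1 hlimC) (ε / 2) (by linarith)
  refine ⟨N, fun n hn => ?_⟩
  have h1 := hN n hn
  have h2 : ∫ ω, min (Z n ω) C ∂P ≤ ∫ ω, Z n ω ∂P :=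
    integral_mono (hmini C n) (hi n) fun ω => min_le_left _ _
  have h3 : ∫ ω, Z n ω ∂P ≤ ∫ ω, min (Z n ω) C ∂P + ε / 4 := by
    have : ∫ ω, Z n ω ∂P ≤ ∫ ω, (min (Z n ω) C + (Z n ω) ^ 2 / (4 * C)) ∂P := by
      refine integral_mono (hi n) ((hmini C n).add ((hi2 n).div_const _)) fun ω => ?_
      simp only
      rcases le_total (Z n ω) C with h | h
      · rw [min_eq_left h]
        have : 0 ≤ (Z n ω) ^ 2 / (4 * C) := by positivity
        linarith
      · rw [min_eq_right h]
        have : Z n ω - C ≤ (Z n ω) ^ 2 / (4 * C) := by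
          rw [le_div_iff₀ (by linarith)]
          nlinarith [sq_nonneg (Z n ω - 2 * C)]
        linarith
    refine this.trans ?_
    rw [integral_add (hmini C n) ((hi2 n).div_const _), integral_div]
    have : (∫ ω, Z n ω ^ 2 ∂P) / (4 * C) ≤ ε / 4 := by
      rw [div_le_iff₀ (by linarith)]
      have := hb n
      rw [div_le_iff₀ hε] at hCB
      nlinarith
    linarith
  rw [Real.dist_eq, abs_lt] at h1 ⊢
  constructor <;> linarith [h1.1, h1.2]


theorem freq_rat (t : ℝ) : ∃ᶠ s : ℝ in nhdsWithin t (Set.Ioi t), ∃ r : ℚ, s = (r : ℝ) := by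
  rw [frequently_iff]
  intro U hU
  obtain ⟨u, hu, hsub⟩ := (mem_nhdsGT_iff_exists_Ioo_subset).1 hU
  obtain ⟨r, h1, h2⟩ := exists_rat_btwn (show t < u from hu)
  exact ⟨r, hsub ⟨h1, h2⟩, r, rfl⟩

namespace SNLevy

variable {Ω : Type} [MeasurableSpace Ω] (L : SNLevy Ω)

/-- the drift -/
def drift : ℝ := L.γ - ∫ y in Set.Ioo (-1 : ℝ) 0, y ∂ L.levyMeasure

theorem ae_neg : ∀ᵐ y ∂ L.levyMeasure, y < 0 := by
  have := L.levySupp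
  rw [ae_iff]
  convert! this using 2
  ext y; simp

theorem min_int (hBVPi : ∫⁻ y in Set.Ioo (-1 : ℝ) 0, ENNReal.ofReal (-y) ∂ L.levyMeasure ≠ ⊤) :
    Integrable (fun y => min 1 |y|) L.levyMeasure := by
  refine ⟨by fun_prop, ?_⟩
  rw [hasFiniteIntegral_iff_ofReal (ae_of_all _ fun y => le_min zero_le_one (abs_nonneg y))]
  have hle : ∫⁻ y, ENNReal.ofReal (min 1 |y|) ∂ L.levyMeasure ≤
      ∫⁻ y, (ENNReal.ofReal (min 1 (y ^ 2)) +
        (Set.Ioo (-1 : ℝ) 0).indicator (fun y => ENNReal.ofReal (-y)) y) ∂ L.levyMeasure := by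
    refine lintegral_mono_ae ?_
    filter_upwards [L.ae_neg] with y hy
    by_cases h : -1 < y
    · rw [Set.indicator_of_mem (show y ∈ Set.Ioo (-1 : ℝ) 0 from ⟨h, hy⟩)]
      refine le_trans (ENNReal.ofReal_le_ofReal ?_) le_add_self
      rw [abs_of_neg hy]; exact min_le_right _ _
    · refine le_trans (ENNReal.ofReal_le_ofReal ?_) le_self_add
      push Not at h
      rw [min_eq_left (show (1 : ℝ) ≤ y ^ 2 by nlinarith)]
      exact min_le_left _ _
  refine lt_of_le_of_lt hle ?_
  rw [lintegral_add_left (by fun_prop), lintegral_indicator measurableSet_Ioo]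
  exact ENNReal.add_lt_top.2 ⟨L.levyInt.lt_top, hBVPi.lt_top⟩

theorem one_sub_exp_bd (l y : ℝ) (hl : 0 ≤ l) (hy : y < 0) :
    0 ≤ 1 - Real.exp (l * y) ∧ 1 - Real.exp (l * y) ≤ max 1 l * min 1 |y| := by
  have h1 : Real.exp (l * y) ≤ 1 := Real.exp_le_one_iff.2 (by nlinarith)
  have h2 := Real.add_one_le_exp (l * y)
  have h3 := Real.exp_pos (l * y)
  refine ⟨by linarith, ?_⟩
  rw [abs_of_neg hy]
  rcases le_total 1 (-y) with h | h
  · rw [min_eq_left h]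
    have := le_max_left 1 l
    linarith
  · rw [min_eq_right h]
    have := le_max_right 1 l
    nlinarith

theorem one_sub_exp_int
    (hBVPi : ∫⁻ y in Set.Ioo (-1 : ℝ) 0, ENNReal.ofReal (-y) ∂ L.levyMeasure ≠ ⊤)
    (l : ℝ) (hl : 0 ≤ l) : Integrable (fun y => 1 - Real.exp (l * y)) L.levyMeasure := by
  refine ((L.min_int hBVPi).const_mul (max 1 l)).mono' (by fun_prop) ?_
  filter_upwards [L.ae_neg] with y hy
  obtain ⟨h1, h2⟩ := one_sub_exp_bd l y hl hy
  rw [Real.norm_eq_abs, abs_of_nonneg h1]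
  exact h2

theorem psi_eq (hBVσ : L.σ2 = 0)
    (hBVPi : ∫⁻ y in Set.Ioo (-1 : ℝ) 0, ENNReal.ofReal (-y) ∂ L.levyMeasure ≠ ⊤)
    (l : ℝ) (hl : 0 ≤ l) :
    L.ψ l = L.drift * l - ∫ y, (1 - Real.exp (l * y)) ∂ L.levyMeasure := by
  rw [L.levyKhintchine l hl, hBVσ]
  have hI : Integrable ((Set.Ioo (-1 : ℝ) 0).indicator (fun y => y)) L.levyMeasure := by
    refine (L.min_int hBVPi).mono' (measurable_id.indicator measurableSet_Ioo).aestronglyMeasurable ?_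
    refine ae_of_all _ fun y => ?_
    by_cases h : y ∈ Set.Ioo (-1 : ℝ) 0
    · rw [Set.indicator_of_mem h, Real.norm_eq_abs]
      rw [min_eq_right]
      rw [abs_of_neg h.2]; linarith [h.1]
    · rw [Set.indicator_of_notMem h, norm_zero]; positivity
  have e : ∫ y, (Real.exp (l * y) - 1 - l * y * (if -1 < y then 1 else 0)) ∂L.levyMeasure
      = ∫ y, (-(1 - Real.exp (l * y)) - l * (Set.Ioo (-1 : ℝ) 0).indicator (fun y => y) y)
        ∂ L.levyMeasure := by
    refine integral_congr_ae ?_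
    filter_upwards [L.ae_neg] with y hy
    by_cases h : -1 < y
    · rw [if_pos h, Set.indicator_of_mem (show y ∈ Set.Ioo (-1 : ℝ) 0 from ⟨h, hy⟩)]; ring
    · rw [if_neg h, Set.indicator_of_notMem (fun h' => h h'.1)]; ring
  have hn : Integrable (fun y => -(1 - Real.exp (l * y))) L.levyMeasure :=
    (L.one_sub_exp_int hBVPi l hl).neg
  rw [e, integral_sub hn (hI.const_mul l), integral_neg,
    integral_const_mul, integral_indicator measurableSet_Ioo]
  simp only [drift]
  ring

theorem tendsto_psi_div (hBVσ : L.σ2 = 0)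
    (hBVPi : ∫⁻ y in Set.Ioo (-1 : ℝ) 0, ENNReal.ofReal (-y) ∂ L.levyMeasure ≠ ⊤) :
    Tendsto (fun l => L.ψ l / l) atTop (nhds L.drift) := by
  have h0 : Tendsto (fun l : ℝ => ∫ y, (1 - Real.exp (l * y)) / l ∂ L.levyMeasure) atTop
      (nhds (∫ _, (0 : ℝ) ∂ L.levyMeasure)) := by
    refine tendsto_integral_filter_of_dominated_convergence (fun y => min 1 |y|)
      (Eventually.of_forall fun l => by fun_prop) ?_ (L.min_int hBVPi) ?_
    · filter_upwards [eventually_ge_atTop (1 : ℝ)] with l hl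
      filter_upwards [L.ae_neg] with y hy
      obtain ⟨h1, h2⟩ := one_sub_exp_bd l y (by linarith) hy
      rw [Real.norm_eq_abs, abs_of_nonneg (by positivity), div_le_iff₀ (by linarith)]
      rw [max_eq_right hl] at h2
      linarith
    · filter_upwards [L.ae_neg] with y hy
      refine squeeze_zero' (g := fun l : ℝ => 1 / l) ?_ ?_ ?_
      · filter_upwards [eventually_ge_atTop (1 : ℝ)] with l hl
        obtain ⟨h1, h2⟩ := one_sub_exp_bd l y (by linarith) hy
        positivity
      · filter_upwards [eventually_ge_atTop (1 : ℝ)] with l hl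
        have := Real.exp_pos (l * y)
        gcongr
        linarith
      · simpa using tendsto_inv_atTop_zero (𝕜 := ℝ)
  rw [integral_zero] at h0
  have h1 : Tendsto (fun l : ℝ => L.drift - ∫ y, (1 - Real.exp (l * y)) / l ∂ L.levyMeasure) atTop
      (nhds (L.drift - 0)) := tendsto_const_nhds.sub h0
  rw [sub_zero] at h1
  refine h1.congr' ?_
  filter_upwards [eventually_ge_atTop (1 : ℝ)] with l hl
  rw [L.psi_eq hBVσ hBVPi l (by linarith), integral_div]
  field_simp

theorem exp_integrable (l : ℝ) (hl : 0 ≤ l) (t : ℝ) (ht : 0 ≤ t) :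
    Integrable (fun ω => Real.exp (l * L.X t ω)) (L.P 0) := by
  by_contra h
  have := L.laplaceExp l hl t ht
  rw [integral_undef h] at this
  exact (Real.exp_pos _).ne this

theorem drift_pos (hBVσ : L.σ2 = 0)
    (hBVPi : ∫⁻ y in Set.Ioo (-1 : ℝ) 0, ENNReal.ofReal (-y) ∂ L.levyMeasure ≠ ⊤) :
    0 < L.drift := by
  have := L.probP 0
  by_contra hc
  push Not at hc
  apply L.notNegSubordinator
  have hψ : ∀ l, 0 ≤ l → L.ψ l ≤ 0 := by
    intro l hl
    rw [L.psi_eq hBVσ hBVPi l hl]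
    have : 0 ≤ ∫ y, (1 - Real.exp (l * y)) ∂ L.levyMeasure := by
      refine integral_nonneg_of_ae ?_
      filter_upwards [L.ae_neg] with y hy
      exact (one_sub_exp_bd l y hl hy).1
    nlinarith
  have hX : ∀ t, 0 ≤ t → ∀ᵐ ω ∂ L.P 0, L.X t ω ≤ 0 := by
    intro t ht
    have hδ : ∀ n : ℕ, (L.P 0) {ω | 1 / ((n : ℝ) + 1) ≤ L.X t ω} = 0 := by
      intro n
      have hb : ∀ k : ℕ, (L.P 0).real {ω | 1 / ((n : ℝ) + 1) ≤ L.X t ω}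
          ≤ Real.exp (-(k : ℝ) * (1 / ((n : ℝ) + 1))) := by
        intro k
        have h1 := measure_ge_le_exp_mul_mgf (μ := L.P 0) (X := L.X t) (1 / ((n : ℝ) + 1))
          (t := (k : ℝ)) (by positivity) (L.exp_integrable k (by positivity) t ht)
        refine h1.trans ?_
        have h2 : mgf (L.X t) (L.P 0) k ≤ 1 := by
          rw [mgf, L.laplaceExp k (by positivity) t ht]
          refine Real.exp_le_one_iff.2 ?_
          have := hψ k (by positivity)
          nlinarith
        have := Real.exp_pos (-(k : ℝ) * (1 / ((n : ℝ) + 1)))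
        nlinarith
      have ht0 : Tendsto (fun k : ℕ => Real.exp (-(k : ℝ) * (1 / ((n : ℝ) + 1)))) atTop (nhds 0) := by
        refine Real.tendsto_exp_atBot.comp ?_
        refine Tendsto.atBot_mul_const (by positivity) ?_
        exact tendsto_neg_atTop_atBot.comp tendsto_natCast_atTop_atTop
      have := ge_of_tendsto' ht0 hb
      have h0 : (L.P 0).real {ω | 1 / ((n : ℝ) + 1) ≤ L.X t ω} = 0 :=
        le_antisymm this measureReal_nonneg
      exact (measureReal_eq_zero_iff).1 h0
    have : ∀ᵐ ω ∂ L.P 0, ∀ n : ℕ, ¬ (1 / ((n : ℝ) + 1) ≤ L.X t ω) := by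
      rw [ae_all_iff]
      intro n
      rw [ae_iff]
      simpa using hδ n
    filter_upwards [this] with ω hω
    by_contra h
    push Not at h
    obtain ⟨n, hn⟩ := exists_nat_one_div_lt h
    exact hω n hn.le
  have hinc : ∀ s t : ℝ, 0 ≤ s → 0 ≤ t → ∀ᵐ ω ∂ L.P 0, L.X (s + t) ω ≤ L.X s ω := by
    intro s t hs ht
    have h1 := hX t ht
    have h2 : ∀ᵐ x ∂ ((L.P 0).map (L.X t)), x ≤ 0 := by
      rw [ae_map_iff (L.measX t).aemeasurable measurableSet_Iic]
      exact h1
    rw [← L.stationaryInc 0 s t hs ht,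
      ae_map_iff (by exact ((L.measX _).sub (L.measX _)).aemeasurable) measurableSet_Iic] at h2
    filter_upwards [h2] with ω hω
    linarith
  have hrat : ∀ᵐ ω ∂ L.P 0, ∀ r r' : ℚ, 0 ≤ r → r ≤ r' → L.X r' ω ≤ L.X r ω := by
    rw [ae_all_iff]; intro r
    rw [ae_all_iff]; intro r'
    by_cases h : 0 ≤ r ∧ r ≤ r'
    · have h1 : (0 : ℝ) ≤ r := by exact_mod_cast h.1
      have h2 : (r : ℝ) ≤ r' := by exact_mod_cast h.2
      filter_upwards [hinc r (r' - r) h1 (by linarith)] with ω hω _ _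
      simpa using hω
    · exact ae_of_all _ fun ω h1 h2 => absurd ⟨h1, h2⟩ h
  filter_upwards [hrat, L.rightCont 0] with ω h1 h2 s t hs hst
  rcases hst.eq_or_lt with rfl | hst
  · exact le_rfl
  have step : ∀ r : ℚ, (0 : ℝ) ≤ r → (r : ℝ) < t → L.X t ω ≤ L.X r ω := by
    intro r hr hrt
    refine le_of_tendsto_of_frequently (h2 t (hs.trans hst.le)) ?_
    refine ((freq_rat t).and_eventually self_mem_nhdsWithin).mono ?_
    rintro u ⟨⟨r', rfl⟩, hu⟩
    refine h1 r r' (by exact_mod_cast hr) ?_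
    have : (r : ℝ) ≤ r' := (hrt.trans hu).le
    exact_mod_cast this
  refine ge_of_tendsto_of_frequently (h2 s hs) ?_
  refine ((freq_rat s).and_eventually (Ioo_mem_nhdsGT hst)).mono ?_
  rintro u ⟨⟨r', rfl⟩, hu⟩
  exact step r' (hs.trans hu.1.le) hu.2

/-- all the large-`l` facts -/
theorem exists_large (hBVσ : L.σ2 = 0)
    (hBVPi : ∫⁻ y in Set.Ioo (-1 : ℝ) 0, ENNReal.ofReal (-y) ∂ L.levyMeasure ≠ ⊤) (q : ℝ) :
    ∃ l₀ : ℝ, 0 ≤ l₀ ∧ ∀ l, l₀ < l → 0 < l ∧ L.Φ q < l ∧ q < L.ψ l := by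
  have hc := L.drift_pos hBVσ hBVPi
  have h1 : Tendsto (fun l => L.ψ l) atTop atTop := by
    have := (L.tendsto_psi_div hBVσ hBVPi).pos_mul_atTop hc tendsto_id
    refine this.congr' ?_
    filter_upwards [eventually_gt_atTop (0 : ℝ)] with l hl
    simp only [id]; field_simp
  obtain ⟨M, hM⟩ := eventually_atTop.1 (h1.eventually_gt_atTop q)
  refine ⟨max 0 (max M (L.Φ q)), le_max_left _ _, fun l hl => ?_⟩
  simp only [max_lt_iff] at hl
  exact ⟨hl.1, hl.2.2, hM l hl.2.1.le⟩

theorem W_tendsto_zero (q : ℝ) (hq : 0 ≤ q) :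
    Tendsto (L.W q) (nhdsWithin 0 (Set.Ioi 0)) (nhds (L.W q 0)) := by
  by_cases h : ∃ y, 0 < y ∧ IntegrableOn (L.W' q) (Set.Ioc 0 y)
  · obtain ⟨y, hy, hi⟩ := h
    have hii : IntervalIntegrable (L.W' q) volume 0 y :=
      (intervalIntegrable_iff_integrableOn_Ioc_of_le hy.le).2 hi
    have hc := intervalIntegral.continuousOn_primitive_interval
      (f := L.W' q) (a := 0) (b := y) (μ := volume) (by
        rw [Set.uIcc_of_le hy.le, integrableOn_Icc_iff_integrableOn_Ioc]; exact hi)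
    have h0 : Tendsto (fun x => ∫ z in (0:ℝ)..x, L.W' q z) (nhdsWithin 0 (Set.Ioi 0)) (nhds 0) := by
      have := (hc 0 (by simp)).tendsto
      rw [intervalIntegral.integral_same] at this
      refine this.mono_left ?_
      rw [Set.uIcc_of_le hy.le]
      exact nhdsWithin_le_iff.2 (mem_of_superset (Ioo_mem_nhdsGT hy) Ioo_subset_Icc_self)
    have h1 := (tendsto_const_nhds (x := L.W q 0)).add h0
    rw [add_zero] at h1
    refine h1.congr' ?_
    filter_upwards [self_mem_nhdsWithin] with x hx
    rw [L.Wabscont q hq x (le_of_lt hx), intervalIntegral.integral_of_le (le_of_lt hx)]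
  · push Not at h
    refine tendsto_const_nhds.congr' ?_
    filter_upwards [self_mem_nhdsWithin] with x hx
    rw [L.Wabscont q hq x (le_of_lt hx), integral_undef (h x hx), add_zero]

theorem W_contOn (q : ℝ) (hq : 0 ≤ q) : ContinuousOn (L.W q) (Set.Ici 0) := by
  intro x hx
  rcases (show (0:ℝ) ≤ x from hx).eq_or_lt with rfl | h
  · have := L.W_tendsto_zero q hq
    rw [← continuousWithinAt_Ioi_iff_Ici]
    exact this
  · exact ((L.Wcont q hq).continuousAt (Ioi_mem_nhds h)).continuousWithinAt

theorem W_rightCont (q : ℝ) (hq : 0 ≤ q) (x : ℝ) :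
    Tendsto (L.W q) (nhdsWithin x (Set.Ioi x)) (nhds (L.W q x)) := by
  rcases lt_trichotomy x 0 with h | h | h
  · rw [L.Wzero q hq x h]
    refine tendsto_const_nhds.congr' ?_
    filter_upwards [mem_nhdsWithin_of_mem_nhds (Iio_mem_nhds h)] with y hy
    rw [L.Wzero q hq y hy]
  · subst h; exact L.W_tendsto_zero q hq
  · exact ((L.Wcont q hq).continuousAt (Ioi_mem_nhds h)).tendsto.mono_left nhdsWithin_le_nhds

theorem W_bdd (q : ℝ) (hq : 0 ≤ q) (M : ℝ) : ∃ C, 0 ≤ C ∧ ∀ x, x ≤ M → L.W q x ≤ C := by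
  obtain ⟨C, hC⟩ := (isCompact_Icc (a := (0:ℝ)) (b := M)).bddAbove_image
    ((L.W_contOn q hq).mono Icc_subset_Ici_self)
  refine ⟨max C 0, le_max_right _ _, fun x hx => ?_⟩
  rcases lt_or_ge x 0 with h | h
  · rw [L.Wzero q hq x h]; exact le_max_right _ _
  · exact (hC ⟨x, ⟨h, hx⟩, rfl⟩).trans (le_max_left _ _)

theorem W_int (q : ℝ) (hq : 0 ≤ q) (l : ℝ) (h1 : L.Φ q < l) (h2 : q < L.ψ l) :
    IntegrableOn (fun y => Real.exp (-l * y) * L.W q y) (Set.Ioi 0) := by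
  by_contra h
  have := L.Wlaplace q hq l h1
  rw [integral_undef h] at this
  have : 0 < 1 / (L.ψ l - q) := by apply one_div_pos.2; linarith
  linarith

theorem W0_pos (hBVσ : L.σ2 = 0)
    (hBVPi : ∫⁻ y in Set.Ioo (-1 : ℝ) 0, ENNReal.ofReal (-y) ∂ L.levyMeasure ≠ ⊤)
    (q : ℝ) (hq : 0 ≤ q) : 0 < L.W q 0 := by
  rcases (L.Wnonneg q hq 0).eq_or_lt with h | h
  swap
  · exact h
  exfalso
  have hc := L.drift_pos hBVσ hBVPi
  obtain ⟨l₀, hl₀, hl⟩ := L.exists_large hBVσ hBVPi q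
  set ε : ℝ := 1 / (2 * L.drift) with hε
  have hεp : 0 < ε := by positivity
  -- limit of l * (1/(ψ l - q))
  have hlim : Tendsto (fun l => l * (1 / (L.ψ l - q))) atTop (nhds (1 / L.drift)) := by
    have h1 : Tendsto (fun l => L.ψ l / l - q / l) atTop (nhds (L.drift - 0)) :=
      (L.tendsto_psi_div hBVσ hBVPi).sub (tendsto_const_nhds.div_atTop tendsto_id)
    rw [sub_zero] at h1
    have h2 := h1.inv₀ hc.ne'
    rw [one_div]
    refine h2.congr' ?_
    filter_upwards [eventually_gt_atTop l₀] with l hl'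
    obtain ⟨a1, a2, a3⟩ := hl l hl'
    rw [← sub_div, inv_div]; ring
  obtain ⟨δ, hδ, hsub⟩ : ∃ δ > 0, ∀ y ∈ Set.Ioo (0:ℝ) δ, L.W q y < ε := by
    have := (L.W_tendsto_zero q hq).eventually_lt_const (show L.W q 0 < ε by rw [← h]; exact hεp)
    obtain ⟨u, hu, hsub⟩ := (mem_nhdsGT_iff_exists_Ioo_subset).1 this
    exact ⟨u, hu, fun y hy => hsub hy⟩
  set l₁ := l₀ + 1
  obtain ⟨b1, b2, b3⟩ := hl l₁ (by simp [l₁])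
  set K : ℝ := ∫ y in Set.Ioi (0:ℝ), Real.exp (-l₁ * y) * L.W q y with hK
  have hbound : ∀ l, l₁ < l → l * (1 / (L.ψ l - q)) ≤ ε + l * Real.exp (-(l - l₁) * δ) * K := by
    intro l hl1
    obtain ⟨a1, a2, a3⟩ := hl l (by linarith [show l₁ = l₀ + 1 from rfl])
    rw [← L.Wlaplace q hq l a2]
    have hexp : IntegrableOn (fun y => ε * Real.exp (-l * y)) (Set.Ioi 0) :=
      (integrableOn_exp_mul_Ioi (by linarith) 0).const_mul ε
    have hle : ∫ y in Set.Ioi (0:ℝ), Real.exp (-l * y) * L.W q y ≤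
        ∫ y in Set.Ioi (0:ℝ), (ε * Real.exp (-l * y) +
          Real.exp (-(l - l₁) * δ) * (Real.exp (-l₁ * y) * L.W q y)) := by
      refine setIntegral_mono_on (L.W_int q hq l a2 a3) (hexp.add
        ((L.W_int q hq l₁ b2 b3).const_mul _)) measurableSet_Ioi fun y hy => ?_
      have e1 := Real.exp_pos (-l * y)
      have w := L.Wnonneg q hq y
      rcases lt_or_ge y δ with hyδ | hyδ
      · have := hsub y ⟨hy, hyδ⟩
        have e2 : 0 ≤ Real.exp (-(l - l₁) * δ) * (Real.exp (-l₁ * y) * L.W q y) := by positivity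
        nlinarith
      · have e2 : Real.exp (-l * y) ≤ Real.exp (-(l - l₁) * δ) * Real.exp (-l₁ * y) := by
          rw [← Real.exp_add]
          refine Real.exp_le_exp.2 ?_
          nlinarith
        have e3 : 0 ≤ ε * Real.exp (-l * y) := by positivity
        nlinarith
    rw [integral_add hexp ((L.W_int q hq l₁ b2 b3).const_mul _), integral_const_mul,
      integral_const_mul, integral_exp_mul_Ioi (by linarith)] at hle
    have : l * ∫ y in Set.Ioi (0:ℝ), Real.exp (-l * y) * L.W q y ≤ l * (ε * (-Real.exp (-l * 0) / -l) +
        Real.exp (-(l - l₁) * δ) * K) := by gcongr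
    refine this.trans (le_of_eq ?_)
    simp only [mul_zero, Real.exp_zero]
    field_simp
  have hz : Tendsto (fun l => ε + l * Real.exp (-(l - l₁) * δ) * K) atTop (nhds (ε + 0 * K)) := by
    refine tendsto_const_nhds.add (Tendsto.mul_const _ ?_)
    have h1 := Real.tendsto_pow_mul_exp_neg_atTop_nhds_zero 1
    have h2 : Tendsto (fun l : ℝ => δ * l) atTop atTop := tendsto_id.const_mul_atTop hδ
    have h3 := ((h1.comp h2).const_mul (Real.exp (l₁ * δ) / δ))
    rw [mul_zero] at h3
    refine h3.congr fun l => ?_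
    simp only [Function.comp, pow_one]
    have : Real.exp (-(l - l₁) * δ) = Real.exp (l₁ * δ) * Real.exp (-(δ * l)) := by
      rw [← Real.exp_add]; ring_nf
    rw [this]; field_simp
  have := le_of_tendsto_of_tendsto hlim hz (by
    filter_upwards [eventually_gt_atTop l₁] with l hl1 using hbound l hl1)
  rw [zero_mul, add_zero, hε] at this
  have h2 : 1 / (2 * L.drift) < 1 / L.drift := by
    apply one_div_lt_one_div_of_lt hc; linarith
  linarith

end SNLevy


/-- rational-time staying predicate -/
def AP (x : ℝ → ℝ) (a b s : ℝ) : Prop := ∀ r : ℚ, 0 < (r : ℝ) → (r : ℝ) < s → -a ≤ x r ∧ x r ≤ b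

/-- exit time through rational times -/
def TP (x : ℝ → ℝ) (a b : ℝ) : ℝ :=
  sInf {s : ℝ | ∃ r : ℚ, s = (r : ℝ) ∧ 0 < (r : ℝ) ∧ ¬ (-a ≤ x r ∧ x r ≤ b)}

/-- right-hand sampling of a path -/
def XR (x : ℝ → ℝ) (s : ℝ) : ℝ :=
  limsup (fun n : ℕ => x (((⌊((n : ℝ) + 1) * s⌋ : ℝ) + 1) / ((n : ℝ) + 1))) atTop

structure GoodPath (x xl : ℝ → ℝ) : Prop where
  x0 : x 0 = 0
  rc : ∀ t : ℝ, 0 ≤ t → Tendsto x (nhdsWithin t (Set.Ioi t)) (nhds (x t))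
  ll : ∀ t : ℝ, 0 < t → Tendsto x (nhdsWithin t (Set.Iio t)) (nhds (xl t))
  np : ∀ t : ℝ, 0 < t → x t ≤ xl t

theorem grid_tendsto (s : ℝ) : Tendsto (fun n : ℕ => ((⌊((n : ℝ) + 1) * s⌋ : ℝ) + 1) / ((n : ℝ) + 1))
    atTop (nhdsWithin s (Set.Ioi s)) := by
  rw [tendsto_nhdsWithin_iff]
  have hn : ∀ n : ℕ, (0 : ℝ) < (n : ℝ) + 1 := fun n => by positivity
  have hlow : ∀ n : ℕ, s < ((⌊((n : ℝ) + 1) * s⌋ : ℝ) + 1) / ((n : ℝ) + 1) := by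
    intro n
    rw [lt_div_iff₀ (hn n)]
    linarith [Int.lt_floor_add_one (((n : ℝ) + 1) * s)]
  refine ⟨?_, Eventually.of_forall hlow⟩
  have h1 : Tendsto (fun n : ℕ => s + 1 / ((n : ℝ) + 1)) atTop (nhds (s + 0)) :=
    tendsto_const_nhds.add tendsto_one_div_add_atTop_nhds_zero_nat
  rw [add_zero] at h1
  refine tendsto_of_tendsto_of_tendsto_of_le_of_le tendsto_const_nhds h1 (fun n => (hlow n).le) ?_
  intro n
  simp only
  rw [div_le_iff₀ (hn n)]
  have e : (s + 1 / ((n : ℝ) + 1)) * ((n : ℝ) + 1) = ((n : ℝ) + 1) * s + 1 := by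
    have := (hn n).ne'
    field_simp
  linarith [Int.floor_le (((n : ℝ) + 1) * s)]

namespace GoodPath

variable {x xl : ℝ → ℝ}

theorem XR_eq (g : GoodPath x xl) (s : ℝ) (hs : 0 ≤ s) : XR x s = x s :=
  ((g.rc s hs).comp (grid_tendsto s)).limsup_eq

end GoodPath

theorem TP_bdd (x : ℝ → ℝ) (a b : ℝ) :
    BddBelow {s : ℝ | ∃ r : ℚ, s = (r : ℝ) ∧ 0 < (r : ℝ) ∧ ¬ (-a ≤ x r ∧ x r ≤ b)} :=
  ⟨0, by rintro s ⟨r, rfl, h, _⟩; exact h.le⟩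

theorem TP_nonneg (x : ℝ → ℝ) (a b : ℝ) : 0 ≤ TP x a b :=
  Real.sInf_nonneg (by rintro s ⟨r, rfl, h, _⟩; exact h.le)

theorem not_AP_iff {x : ℝ → ℝ} {a b s : ℝ} : ¬ AP x a b s ↔
    ∃ r : ℚ, 0 < (r : ℝ) ∧ (r : ℝ) < s ∧ ¬ (-a ≤ x r ∧ x r ≤ b) := by
  unfold AP; push Not; rfl

theorem AP_mono {x : ℝ → ℝ} {a b s s' : ℝ} (h : s' ≤ s) (hA : AP x a b s) : AP x a b s' :=
  fun r h0 h1 => hA r h0 (h1.trans_le h)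

/-- some exit occurs -/
def EX (x : ℝ → ℝ) (a b : ℝ) : Prop := ∃ s, ¬ AP x a b s

theorem EX_nonempty {x : ℝ → ℝ} {a b : ℝ} (h : EX x a b) :
    {s : ℝ | ∃ r : ℚ, s = (r : ℝ) ∧ 0 < (r : ℝ) ∧ ¬ (-a ≤ x r ∧ x r ≤ b)}.Nonempty := by
  obtain ⟨s, hs⟩ := h
  obtain ⟨r, h0, _, h2⟩ := not_AP_iff.1 hs
  exact ⟨r, r, rfl, h0, h2⟩

theorem AP_iff {x : ℝ → ℝ} {a b : ℝ} (h : EX x a b) (s : ℝ) : AP x a b s ↔ s ≤ TP x a b := by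
  constructor
  · intro hA
    refine le_csInf (EX_nonempty h) ?_
    rintro u ⟨r, rfl, h0, h1⟩
    by_contra hlt
    push Not at hlt
    exact h1 (hA r h0 hlt)
  · intro hs r h0 h1
    by_contra hn
    have : TP x a b ≤ r := csInf_le (TP_bdd x a b) ⟨r, rfl, h0, hn⟩
    linarith

theorem AP_nonpos (x : ℝ → ℝ) (a b s : ℝ) (hs : s ≤ 0) : AP x a b s :=
  fun r h0 h1 => by linarith

theorem EX_of_TP_lt {x : ℝ → ℝ} {a b s : ℝ} (h : EX x a b) (hlt : TP x a b < s) : ¬ AP x a b s := by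
  rw [AP_iff h]; linarith

namespace GoodPath

variable {x xl : ℝ → ℝ}

theorem mem_of_lt (g : GoodPath x xl) {a b t s : ℝ} (hA : AP x a b t) (hs : 0 ≤ s) (hst : s < t) :
    -a ≤ x s ∧ x s ≤ b := by
  have hf := (freq_rat s).and_eventually (Ioo_mem_nhdsGT hst)
  constructor
  · refine ge_of_tendsto_of_frequently (g.rc s hs) (hf.mono ?_)
    rintro u ⟨⟨r, rfl⟩, hu⟩
    exact (hA r (hs.trans_lt hu.1) hu.2).1
  · refine le_of_tendsto_of_frequently (g.rc s hs) (hf.mono ?_)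
    rintro u ⟨⟨r, rfl⟩, hu⟩
    exact (hA r (hs.trans_lt hu.1) hu.2).2

theorem le_of_AP (g : GoodPath x xl) {a b t : ℝ} (hb : 0 ≤ b) (hA : AP x a b t) (ht : 0 ≤ t) :
    x t ≤ b := by
  rcases ht.eq_or_lt with rfl | ht
  · rw [g.x0]; exact hb
  · refine (g.np t ht).trans (le_of_tendsto (g.ll t ht) ?_)
    filter_upwards [Ioo_mem_nhdsLT ht] with s hs
    exact (g.mem_of_lt hA hs.1.le hs.2).2

theorem TP_le (g : GoodPath x xl) {a b : ℝ} (hb : 0 ≤ b) (h : EX x a b) : x (TP x a b) ≤ b :=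
  g.le_of_AP hb ((AP_iff h _).2 le_rfl) (TP_nonneg x a b)

theorem TP_or (g : GoodPath x xl) {a b : ℝ} (hb : 0 ≤ b) (h : EX x a b) :
    x (TP x a b) ≤ -a ∨ x (TP x a b) = b := by
  by_contra hn
  push Not at hn
  obtain ⟨h1, h2⟩ := hn
  have h3 : x (TP x a b) < b := lt_of_le_of_ne (g.TP_le hb h) h2
  have hev := (g.rc _ (TP_nonneg x a b)) (Ioo_mem_nhds h1 h3)
  obtain ⟨u, hu, hsub⟩ := (mem_nhdsGT_iff_exists_Ioo_subset).1 hev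
  refine EX_of_TP_lt h hu fun r h0 hr => ?_
  rcases lt_trichotomy (r : ℝ) (TP x a b) with h4 | h4 | h4
  · exact (AP_iff h _).2 le_rfl r h0 h4
  · rw [h4]; exact ⟨h1.le, h3.le⟩
  · exact ⟨(hsub ⟨h4, hr⟩).1.le, (hsub ⟨h4, hr⟩).2.le⟩

/-- convergence of exit times as the lower level tends to zero -/
theorem TP_tendsto (g : GoodPath x xl) {b : ℝ} (a : ℕ → ℝ) (ha : ∀ n, 0 < a n)
    (hlim : Tendsto a atTop (nhds 0)) (hE : ∀ n, EX x (a n) b) (h : EX x 0 b) :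
    Tendsto (fun n => x (TP x (a n) b)) atTop (nhds (x (TP x 0 b))) ∧
    Tendsto (fun n => TP x (a n) b) atTop (nhds (TP x 0 b)) := by
  have hle : ∀ n, TP x 0 b ≤ TP x (a n) b := by
    intro n
    rw [← AP_iff (hE n)]
    intro r h0 h1
    have := (AP_iff h _).2 le_rfl r h0 h1
    exact ⟨by linarith [ha n, this.1], this.2⟩
  have hT : Tendsto (fun n => TP x (a n) b) atTop (nhds (TP x 0 b)) := by
    refine tendsto_order.2 ⟨fun s hs => Eventually.of_forall fun n => hs.trans_le (hle n), ?_⟩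
    intro s hs
    obtain ⟨r, h0, hr, hn⟩ := not_AP_iff.1 (EX_of_TP_lt h hs)
    rcases not_and_or.1 hn with h1 | h1
    · push Not at h1
      have : ∀ᶠ n in atTop, a n < - x r :=
        (tendsto_order.1 hlim).2 _ (by linarith)
      filter_upwards [this] with n hn
      refine lt_of_le_of_lt ?_ hr
      exact csInf_le (TP_bdd x (a n) b) ⟨r, rfl, h0, fun h' => by linarith [h'.1]⟩
    · refine Eventually.of_forall fun n => lt_of_le_of_lt ?_ hr
      exact csInf_le (TP_bdd x (a n) b) ⟨r, rfl, h0, fun h' => h1 h'.2⟩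
  refine ⟨?_, hT⟩
  have hc : ContinuousWithinAt x (Set.Ici (TP x 0 b)) (TP x 0 b) := by
    rw [← continuousWithinAt_Ioi_iff_Ici]; exact g.rc _ (TP_nonneg x 0 b)
  refine hc.tendsto.comp (tendsto_nhdsWithin_iff.2 ⟨hT, Eventually.of_forall hle⟩)

theorem rat_right (g : GoodPath x xl) {t : ℝ} (ht : 0 ≤ t) {U : Set ℝ} (hU : IsOpen U) (hx : x t ∈ U)
    {u : ℝ} (hu : t < u) : ∃ r : ℚ, t < r ∧ (r : ℝ) < u ∧ x r ∈ U := by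
  have := (freq_rat t).and_eventually (((g.rc t ht).eventually (hU.mem_nhds hx)).and (Ioo_mem_nhdsGT hu))
  obtain ⟨s, ⟨r, rfl⟩, h1, h2⟩ := this.exists
  exact ⟨r, h2.1, h2.2, h1⟩

/-- link with the extended-real first passage times -/
theorem link (g : GoodPath x xl) {b : ℝ} (hb : 0 < b) (h : EX x 0 b) (τ₀ τb : ℝ≥0∞)
    (h0 : τ₀ = sInf {t : ℝ≥0∞ | t ≠ ⊤ ∧ 0 < t ∧ x t.toReal < 0})
    (hbb : τb = sInf {t : ℝ≥0∞ | t ≠ ⊤ ∧ 0 < t ∧ b < x t.toReal}) :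
    (τ₀ < τb → τ₀ ≠ ⊤ ∧ τ₀.toReal = TP x 0 b ∧ x (TP x 0 b) ≤ 0) ∧
    (¬ τ₀ < τb → 0 ≤ x (TP x 0 b)) := by
  constructor
  · intro hlt
    have hne : τ₀ ≠ ⊤ := (hlt.trans_le le_top).ne
    have hmem : ∀ t ∈ {t : ℝ≥0∞ | t ≠ ⊤ ∧ 0 < t ∧ x t.toReal < 0}, TP x 0 b ≤ t.toReal := by
      rintro t ⟨t1, t2, t3⟩
      refine le_of_forall_gt_imp_ge_of_dense fun u hu => ?_
      obtain ⟨r, r1, r2, r3⟩ := g.rat_right (t := t.toReal) ENNReal.toReal_nonneg isOpen_Iio t3 hu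
      refine le_trans (csInf_le (TP_bdd x 0 b) ⟨r, rfl, ?_, ?_⟩) r2.le
      · exact lt_of_le_of_lt ENNReal.toReal_nonneg r1
      · intro h'; have := h'.1; have : x r < 0 := r3; linarith
    have hTle : TP x 0 b ≤ τ₀.toReal := by
      have : ENNReal.ofReal (TP x 0 b) ≤ τ₀ := by
        rw [h0]
        refine le_sInf fun t ht => ?_
        exact ENNReal.ofReal_le_of_le_toReal (hmem t ht)
      exact (ENNReal.ofReal_le_iff_le_toReal hne).1 this
    have hle : τ₀.toReal ≤ TP x 0 b := by
      refine le_csInf (EX_nonempty h) ?_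
      rintro u ⟨r, rfl, r0, r1⟩
      refine ENNReal.toReal_le_of_le_ofReal r0.le ?_
      have e : (ENNReal.ofReal (r : ℝ)).toReal = r := ENNReal.toReal_ofReal r0.le
      rcases not_and_or.1 r1 with h1 | h1
      · rw [h0]
        refine sInf_le ⟨ENNReal.ofReal_ne_top, ENNReal.ofReal_pos.2 r0, ?_⟩
        rw [e]; push Not at h1; linarith
      · refine hlt.le.trans ?_
        rw [hbb]
        refine sInf_le ⟨ENNReal.ofReal_ne_top, ENNReal.ofReal_pos.2 r0, ?_⟩
        rw [e]; push Not at h1; exact h1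
    have heq := le_antisymm hle hTle
    refine ⟨hne, heq, ?_⟩
    by_contra hpos
    push Not at hpos
    have hev := (g.rc _ (TP_nonneg x 0 b)) (Ioi_mem_nhds hpos)
    obtain ⟨u, hu, hsub⟩ := (mem_nhdsGT_iff_exists_Ioo_subset).1 hev
    have hτu : τ₀ < ENNReal.ofReal u := by
      rw [← ENNReal.ofReal_toReal hne, heq]
      exact (ENNReal.ofReal_lt_ofReal_iff (lt_of_le_of_lt (TP_nonneg x 0 b) hu)).2 hu
    rw [h0, sInf_lt_iff] at hτu
    obtain ⟨t, ht, htu⟩ := hτu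
    have h1 := hmem t ht
    have h2 : t.toReal < u := by
      rw [← ENNReal.toReal_ofReal (show 0 ≤ u from (lt_of_le_of_lt (TP_nonneg x 0 b) hu).le)]
      exact (ENNReal.toReal_lt_toReal ht.1 ENNReal.ofReal_ne_top).2 htu
    rcases h1.eq_or_lt with h3 | h3
    · have := ht.2.2; rw [← h3] at this; linarith
    · have : 0 < x t.toReal := hsub ⟨h3, h2⟩
      linarith [ht.2.2]
  · intro hn
    by_contra hneg
    push Not at hneg
    apply hn
    have hTpos : 0 < TP x 0 b := by
      rcases (TP_nonneg x 0 b).eq_or_lt with h1 | h1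
      · rw [← h1, g.x0] at hneg; exact absurd hneg (lt_irrefl _)
      · exact h1
    have hev := (g.rc _ (TP_nonneg x 0 b)) (Iio_mem_nhds hneg)
    obtain ⟨u, hu, hsub⟩ := (mem_nhdsGT_iff_exists_Ioo_subset).1 hev
    have h1 : τ₀ ≤ ENNReal.ofReal (TP x 0 b) := by
      rw [h0]
      refine sInf_le ⟨ENNReal.ofReal_ne_top, ENNReal.ofReal_pos.2 hTpos, ?_⟩
      rw [ENNReal.toReal_ofReal hTpos.le]; exact hneg
    have h2 : ENNReal.ofReal u ≤ τb := by
      rw [hbb]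
      refine le_sInf ?_
      rintro t ⟨t1, t2, t3⟩
      refine ENNReal.ofReal_le_of_le_toReal ?_
      by_contra htu
      push Not at htu
      obtain ⟨r, r1, r2, r3⟩ := g.rat_right (t := t.toReal) ENNReal.toReal_nonneg isOpen_Ioi t3 htu
      have r3' : b < x r := r3
      have : TP x 0 b ≤ r := csInf_le (TP_bdd x 0 b)
        ⟨r, rfl, lt_of_le_of_lt ENNReal.toReal_nonneg r1, fun h' => by linarith [h'.2]⟩
      rcases this.eq_or_lt with h3 | h3
      · rw [h3] at hneg; linarith
      · have : x r < 0 := hsub ⟨h3, r2⟩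
        linarith
    refine lt_of_le_of_lt h1 (lt_of_lt_of_le ?_ h2)
    exact (ENNReal.ofReal_lt_ofReal_iff (lt_of_le_of_lt (TP_nonneg x 0 b) hu)).2 hu

end GoodPath

/-! measurability -/

theorem measurable_XR {Ω : Type*} [MeasurableSpace Ω] (X : ℝ → Ω → ℝ) (hX : ∀ t, Measurable (X t)) :
    Measurable (fun p : ℝ × Ω => XR (fun s => X s p.2) p.1) := by
  unfold XR
  refine Measurable.limsup fun n => ?_
  have h1 : Measurable (fun p : ℤ × Ω => X (((p.1 : ℝ) + 1) / ((n : ℝ) + 1)) p.2) :=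
    measurable_from_prod_countable_right fun k => hX (((k : ℝ) + 1) / ((n : ℝ) + 1))
  exact h1.comp (g := fun p : ℤ × Ω => X (((p.1 : ℝ) + 1) / ((n : ℝ) + 1)) p.2)
    (f := fun p : ℝ × Ω => (⌊((n : ℝ) + 1) * p.1⌋, p.2))
    (((measurable_fst.const_mul _).floor).prodMk measurable_snd)

theorem measurableSet_AP {Ω : Type*} [MeasurableSpace Ω] (X : ℝ → Ω → ℝ) (a b s : ℝ)
    (hX : ∀ t, 0 ≤ t → t ≤ s → Measurable (X t)) :
    MeasurableSet {ω | AP (fun u => X u ω) a b s} := by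
  unfold AP
  simp only [Set.ofPred_forall]
  refine MeasurableSet.iInter fun r => MeasurableSet.iInter fun h0 => MeasurableSet.iInter fun h1 => ?_
  have := hX r h0.le h1.le
  exact (measurableSet_le measurable_const this).inter (measurableSet_le this measurable_const)

theorem measurableSet_AP_prod {Ω : Type*} [MeasurableSpace Ω] (X : ℝ → Ω → ℝ) (a b : ℝ)
    (hX : ∀ t, Measurable (X t)) :
    MeasurableSet {p : ℝ × Ω | AP (fun u => X u p.2) a b p.1} := by
  unfold AP
  simp only [Set.ofPred_forall]
  refine MeasurableSet.iInter fun r => MeasurableSet.iInter fun h0 => ?_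
  have e : {p : ℝ × Ω | (r : ℝ) < p.1 → -a ≤ X r p.2 ∧ X r p.2 ≤ b} =
      {p : ℝ × Ω | (r : ℝ) < p.1}ᶜ ∪ ({p | -a ≤ X r p.2} ∩ {p | X r p.2 ≤ b}) := by
    ext p; simp [imp_iff_not_or]
  have this : Measurable (fun p : ℝ × Ω => X r p.2) := (hX r).comp measurable_snd
  have key : MeasurableSet {p : ℝ × Ω | (r : ℝ) < p.1 → -a ≤ X r p.2 ∧ X r p.2 ≤ b} := by
    rw [e]
    exact ((measurableSet_lt measurable_const measurable_fst).compl).union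
      ((measurableSet_le measurable_const this).inter (measurableSet_le this measurable_const))
  convert! key using 1

theorem measurable_TP {Ω : Type*} [MeasurableSpace Ω] (X : ℝ → Ω → ℝ) (a b : ℝ)
    (hX : ∀ t, Measurable (X t)) : Measurable (fun ω => TP (fun u => X u ω) a b) := by
  have hA : ∀ s, MeasurableSet {ω | AP (fun u => X u ω) a b s} := fun s =>
    measurableSet_AP X a b s fun t _ _ => hX t
  have hE : MeasurableSet {ω | EX (fun u => X u ω) a b} := by
    have : {ω | EX (fun u => X u ω) a b} = ⋃ n : ℕ, {ω | AP (fun u => X u ω) a b n}ᶜ := by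
      ext ω
      simp only [EX, Set.mem_ofPred_eq, Set.mem_iUnion, Set.mem_compl_iff]
      constructor
      · rintro ⟨s, hs⟩
        obtain ⟨n, hn⟩ := exists_nat_ge s
        exact ⟨n, fun h => hs (AP_mono hn h)⟩
      · rintro ⟨n, hn⟩; exact ⟨n, hn⟩
    rw [this]
    exact MeasurableSet.iUnion fun n => (hA n).compl
  refine measurable_of_Ici fun s => ?_
  have : (fun ω => TP (fun u => X u ω) a b) ⁻¹' Set.Ici s =
      ({ω | EX (fun u => X u ω) a b} ∩ {ω | AP (fun u => X u ω) a b s}) ∪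
      ({ω | EX (fun u => X u ω) a b}ᶜ ∩ {_ω | s ≤ 0}) := by
    ext ω
    by_cases h : EX (fun u => X u ω) a b
    · simp [h, AP_iff h]
    · have h0 : TP (fun u => X u ω) a b = 0 := by
        unfold TP
        have : {s : ℝ | ∃ r : ℚ, s = (r : ℝ) ∧ 0 < (r : ℝ) ∧ ¬ (-a ≤ X r ω ∧ X r ω ≤ b)} = ∅ := by
          rw [Set.eq_empty_iff_forall_notMem]
          rintro u ⟨r, rfl, r0, r1⟩
          exact h ⟨r + 1, fun hA => r1 (hA r r0 (by linarith))⟩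
        rw [this, Real.sInf_empty]
      simp [h, h0]
  rw [this]
  exact (hE.inter (hA s)).union (hE.compl.inter (by simp))



/-- stopped discrete sums -/
theorem stop_sum (K : ℕ) (A : ℕ → Prop) (hA : ∀ k, A (k + 1) → A k) :
    ∃ j ≤ K, (∀ k < j, A k) ∧ (j < K → ¬ A j) ∧ ∀ m : ℕ → ℝ,
      m 0 + ∑ k ∈ Finset.range K, Set.indicator {k | A k} (fun k => m (k + 1) - m k) k = m j := by
  classical
  have hdown : ∀ i j : ℕ, i ≤ j → A j → A i := by
    intro i j hij
    induction hij with
    | refl => exact id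
    | step _ ih => exact fun h => ih (hA _ h)
  induction K with
  | zero => exact ⟨0, le_rfl, by simp, by simp, by simp⟩
  | succ K ih =>
    obtain ⟨j, hj, h1, h2, h3⟩ := ih
    rcases hj.eq_or_lt with rfl | hlt
    · by_cases hAj : A j
      · refine ⟨j + 1, le_rfl, fun k hk => hdown k j (by omega) hAj, by simp, fun m => ?_⟩
        rw [Finset.sum_range_succ, ← add_assoc, h3 m, Set.indicator_of_mem (by exact hAj)]
        ring
      · refine ⟨j, by omega, h1, fun _ => hAj, fun m => ?_⟩
        rw [Finset.sum_range_succ, ← add_assoc, h3 m, Set.indicator_of_notMem (by exact hAj)]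
        ring
    · refine ⟨j, by omega, h1, fun _ => h2 hlt, fun m => ?_⟩
      rw [Finset.sum_range_succ, ← add_assoc, h3 m,
        Set.indicator_of_notMem (fun h : K ∈ {k | A k} => h2 hlt (hdown j K hlt.le h))]
      ring

theorem ind_comap_le {Ω : Type*} (F : MeasurableSpace Ω) (X : ℝ → Ω → ℝ) (a b u l p : ℝ)
    (hu : 0 ≤ u)
    (hX : ∀ v, 0 ≤ v → v ≤ u → MeasurableSpace.comap (X v) inferInstance ≤ F) :
    MeasurableSpace.comap ({ω | AP (fun u => X u ω) a b u}.indicator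
      (fun ω => Real.exp (l * X u ω - p))) inferInstance ≤ F := by
  have hX' : ∀ v, 0 ≤ v → v ≤ u → Measurable (X v) := fun v h0 h1 =>
    measurable_iff_comap_le.2 (hX v h0 h1)
  have h1 : Measurable (fun ω => Real.exp (l * X u ω - p)) :=
    Real.measurable_exp.comp (((hX' u hu le_rfl).const_mul l).sub_const _)
  exact (h1.indicator (measurableSet_AP X a b u hX')).comap_le

namespace SNLevy

variable {Ω : Type} [MeasurableSpace Ω] (L : SNLevy Ω)

theorem good : ∀ᵐ ω ∂ L.P 0, GoodPath (fun s => L.X s ω) (fun s => L.Xlim s ω) := by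
  filter_upwards [L.start 0, L.rightCont 0, L.leftLimit 0, L.noPosJumps 0] with ω h1 h2 h3 h4
  exact ⟨h1, h2, h3, h4⟩

/-- exponential process -/
def M (l p s : ℝ) (ω : Ω) : ℝ := Real.exp (l * L.X s ω - p * s)

/-- staying event -/
def A (a b s : ℝ) : Set Ω := {ω | AP (fun u => L.X u ω) a b s}

theorem mem_A {a b s : ℝ} {ω : Ω} : ω ∈ L.A a b s ↔ AP (fun u => L.X u ω) a b s := Iff.rfl

theorem A_meas (a b s : ℝ) : MeasurableSet (L.A a b s) :=
  measurableSet_AP L.X a b s fun t _ _ => L.measX t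

theorem M_meas (l p s : ℝ) : Measurable (L.M l p s) :=
  Real.measurable_exp.comp (((L.measX s).const_mul l).sub_const _)

theorem M_pos (l p s : ℝ) (ω : Ω) : 0 < L.M l p s ω := Real.exp_pos _

theorem M_sq (l p s : ℝ) (ω : Ω) : L.M l p s ω ^ 2 = L.M (2 * l) (2 * p) s ω := by
  unfold M; rw [← Real.exp_nat_mul]; congr 1; push_cast; ring

theorem M_eq (l p s : ℝ) : L.M l p s = fun ω => Real.exp (-p * s) * Real.exp (l * L.X s ω) := by
  funext ω; unfold M; rw [← Real.exp_add]; congr 1; ring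

theorem M_int (l p s : ℝ) (hl : 0 ≤ l) (hs : 0 ≤ s) : Integrable (L.M l p s) (L.P 0) := by
  rw [M_eq]; exact (L.exp_integrable l hl s hs).const_mul _

theorem M_integral (l p s : ℝ) (hl : 0 ≤ l) (hs : 0 ≤ s) :
    ∫ ω, L.M l p s ω ∂ L.P 0 = Real.exp ((L.ψ l - p) * s) := by
  rw [M_eq, integral_const_mul, L.laplaceExp l hl s hs, ← Real.exp_add]; congr 1; ring

/-- mean of stopped exponential on staying event -/
def phi (a b l p s : ℝ) : ℝ := ∫ ω in L.A a b s, L.M l p s ω ∂ L.P 0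

theorem phi_nonneg (a b l p s : ℝ) : 0 ≤ L.phi a b l p s :=
  setIntegral_nonneg (L.A_meas a b s) fun ω _ => (L.M_pos l p s ω).le

theorem indep_step (a b l p : ℝ) (hl : 0 ≤ l) (u s : ℝ) (hu : 0 ≤ u) (hus : u ≤ s) :
    ∫ ω in L.A a b u, L.M l p s ω ∂ L.P 0 =
      L.phi a b l p u * Real.exp ((L.ψ l - p) * (s - u)) := by
  have := L.probP 0
  unfold phi
  rw [← integral_indicator (L.A_meas a b u), ← integral_indicator (L.A_meas a b u)]
  have hI := L.indepInc 0 u (s - u) hu (by linarith)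
  have hst := L.stationaryInc 0 u (s - u) hu (by linarith)
  have e : u + (s - u) = s := by ring
  rw [e] at hI hst
  let D : Ω → ℝ := fun ω => L.X s ω - L.X u ω
  have hDm : Measurable D := (L.measX s).sub (L.measX u)
  have hk : Measurable (fun d : ℝ => Real.exp (l * d - p * (s - u))) := by fun_prop
  have hind : IndepFun (fun ω => Real.exp (l * D ω - p * (s - u)))
      ((L.A a b u).indicator (L.M l p u)) (L.P 0) := by
    rw [IndepFun_iff_Indep]
    refine indep_of_indep_of_le_left (indep_of_indep_of_le_right hI ?_) ?_
    · exact ind_comap_le _ L.X a b u l (p * u) hu fun v h0 h1 =>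
        le_iSup₂_of_le (f := fun v (_ : v ∈ Set.Icc (0 : ℝ) u) =>
          MeasurableSpace.comap (L.X v) inferInstance) v ⟨h0, h1⟩ le_rfl
    · exact (hk.comp (comap_measurable D)).comap_le
  have key := hind.integral_fun_mul_eq_mul_integral
    (hk.comp hDm).aestronglyMeasurable
    ((L.M_meas l p u).indicator (L.A_meas a b u)).aestronglyMeasurable
  have e1 : ∫ ω, Real.exp (l * D ω - p * (s - u)) ∂ L.P 0 =
      Real.exp ((L.ψ l - p) * (s - u)) := by
    have h1 : ∫ ω, Real.exp (l * D ω - p * (s - u)) ∂ L.P 0 =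
        ∫ d, Real.exp (l * d - p * (s - u)) ∂ ((L.P 0).map D) :=
      (integral_map hDm.aemeasurable hk.aestronglyMeasurable).symm
    rw [h1, hst, integral_map (L.measX _).aemeasurable hk.aestronglyMeasurable]
    exact L.M_integral l p (s - u) hl (by linarith)
  rw [e1] at key
  rw [mul_comm, ← key]
  refine integral_congr_ae (Eventually.of_forall fun ω => ?_)
  by_cases hω : ω ∈ L.A a b u
  · simp only [Set.indicator_of_mem hω, M, D, ← Real.exp_add]; congr 1; ring
  · simp only [Set.indicator_of_notMem hω, mul_zero]

/-- normalised antitone function -/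
def gg (a b l p s : ℝ) : ℝ := Real.exp (-(L.ψ l - p) * max s 0) * L.phi a b l p (max s 0)

theorem gg_nonneg (a b l p s : ℝ) : 0 ≤ L.gg a b l p s :=
  mul_nonneg (Real.exp_pos _).le (L.phi_nonneg _ _ _ _ _)

theorem gg_anti (a b l p : ℝ) (hl : 0 ≤ l) : Antitone (L.gg a b l p) := by
  intro u s hus
  unfold gg
  have h0 : 0 ≤ max u 0 := le_max_right _ _
  have h1 : max u 0 ≤ max s 0 := max_le_max_right 0 hus
  generalize max u 0 = u' at *
  generalize max s 0 = s' at *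
  have h2 : L.phi a b l p s' ≤ L.phi a b l p u' * Real.exp ((L.ψ l - p) * (s' - u')) := by
    rw [← L.indep_step a b l p hl u' s' h0 h1]
    exact setIntegral_mono_set (L.M_int l p s' hl (h0.trans h1)).integrableOn
      (Eventually.of_forall fun ω => (L.M_pos l p s' ω).le)
      (LE.le.eventuallyLE fun ω hω => L.mem_A.2 (AP_mono h1 (L.mem_A.1 hω)))
  calc Real.exp (-(L.ψ l - p) * s') * L.phi a b l p s' ≤
      Real.exp (-(L.ψ l - p) * s') * (L.phi a b l p u' * Real.exp ((L.ψ l - p) * (s' - u'))) := by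
        gcongr
    _ = (Real.exp (-(L.ψ l - p) * s') * Real.exp ((L.ψ l - p) * (s' - u'))) * L.phi a b l p u' := by
        ring
    _ = _ := by rw [← Real.exp_add]; congr 2; ring

theorem gg_zero (a b l p : ℝ) (hl : 0 ≤ l) : L.gg a b l p 0 = 1 := by
  have hA : L.A a b 0 = Set.univ := by
    ext ω; simp only [Set.mem_univ, iff_true]; exact L.mem_A.2 (AP_nonpos _ _ _ _ le_rfl)
  simp [gg, phi, hA, L.M_integral l p 0 hl le_rfl]

theorem gg_le_one (a b l p : ℝ) (hl : 0 ≤ l) (s : ℝ) : L.gg a b l p s ≤ 1 := by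
  have : L.gg a b l p s = L.gg a b l p (max s 0) := by simp [gg]
  rw [this, ← L.gg_zero a b l p hl]
  exact L.gg_anti a b l p hl (le_max_right _ _)

theorem phi_eq (a b l p s : ℝ) (hs : 0 ≤ s) :
    L.phi a b l p s = L.gg a b l p s * Real.exp ((L.ψ l - p) * s) := by
  unfold gg
  rw [max_eq_left hs, mul_right_comm, ← Real.exp_add, neg_mul, neg_add_cancel, Real.exp_zero,
    one_mul]

/-- discretised stopped process -/
def Z (a b l p t : ℝ) (n : ℕ) (ω : Ω) : ℝ :=
  L.M l p 0 ω + ∑ k ∈ Finset.range (n + 1),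
    (L.A a b (k * (t / (n + 1)))).indicator
      (fun ω => L.M l p ((k + 1) * (t / (n + 1))) ω - L.M l p (k * (t / (n + 1))) ω) ω

theorem Z_spec (a b t : ℝ) (ht : 0 ≤ t) (n : ℕ) (ω : Ω) : ∃ j ≤ n + 1,
    (∀ k < j, ω ∈ L.A a b ((k : ℝ) * (t / (n + 1)))) ∧
    (j < n + 1 → ω ∉ L.A a b ((j : ℝ) * (t / (n + 1)))) ∧
    ∀ l p, L.Z a b l p t n ω = L.M l p (j * (t / (n + 1))) ω := by
  have hh : 0 ≤ t / ((n : ℝ) + 1) := by positivity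
  obtain ⟨j, h1, h2, h3, h4⟩ := stop_sum (n + 1) (fun k => ω ∈ L.A a b ((k : ℝ) * (t / (n + 1))))
    (fun k hk => L.mem_A.2 (AP_mono (by push_cast; nlinarith) (L.mem_A.1 hk)))
  refine ⟨j, h1, h2, h3, fun l p => ?_⟩
  rw [← h4 (fun k => L.M l p ((k : ℝ) * (t / (n + 1))) ω)]
  unfold Z
  congr 1
  · simp
  · refine Finset.sum_congr rfl fun k _ => ?_
    by_cases hk : ω ∈ L.A a b ((k : ℝ) * (t / (n + 1)))
    · rw [Set.indicator_of_mem hk, Set.indicator_of_mem (by exact hk)]; push_cast; rfl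
    · rw [Set.indicator_of_notMem hk, Set.indicator_of_notMem (by exact hk)]

theorem Z_int (a b l p t : ℝ) (hl : 0 ≤ l) (ht : 0 ≤ t) (n : ℕ) :
    Integrable (L.Z a b l p t n) (L.P 0) := by
  refine (L.M_int l p 0 hl le_rfl).add (integrable_finsetSum _ fun k _ => ?_)
  exact ((L.M_int l p _ hl (by positivity)).sub (L.M_int l p _ hl (by positivity))).indicator
    (L.A_meas _ _ _)

theorem Z_integral (a b l p t : ℝ) (hl : 0 ≤ l) (ht : 0 ≤ t) (n : ℕ) :
    ∫ ω, L.Z a b l p t n ω ∂ L.P 0 = 1 + ∑ k ∈ Finset.range (n + 1),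
      L.gg a b l p (k * (t / (n + 1))) *
        (Real.exp ((L.ψ l - p) * ((k + 1) * (t / (n + 1)))) -
          Real.exp ((L.ψ l - p) * (k * (t / (n + 1))))) := by
  unfold Z
  have hi : ∀ k ∈ Finset.range (n + 1), Integrable ((L.A a b (k * (t / (n + 1)))).indicator
      (fun ω => L.M l p ((k + 1) * (t / (n + 1))) ω - L.M l p (k * (t / (n + 1))) ω)) (L.P 0) :=
    fun k _ => ((L.M_int l p _ hl (by positivity)).sub
      (L.M_int l p _ hl (by positivity))).indicator (L.A_meas _ _ _)
  rw [integral_add (L.M_int l p 0 hl le_rfl) (integrable_finsetSum _ hi), integral_finsetSum _ hi,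
    L.M_integral l p 0 hl le_rfl, mul_zero, Real.exp_zero]
  congr 1
  refine Finset.sum_congr rfl fun k _ => ?_
  have hk : 0 ≤ (k : ℝ) * (t / (n + 1)) := by positivity
  have hh : 0 ≤ t / ((n : ℝ) + 1) := by positivity
  rw [integral_indicator (L.A_meas _ _ _), integral_sub
    (L.M_int l p _ hl (by positivity)).integrableOn (L.M_int l p _ hl hk).integrableOn,
    L.indep_step a b l p hl _ _ hk (by nlinarith)]
  change _ - L.phi a b l p _ = _
  rw [L.phi_eq a b l p _ hk]
  rw [mul_assoc, ← Real.exp_add, mul_sub]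
  ring_nf

end SNLevy


namespace SNLevy

variable {Ω : Type} [MeasurableSpace Ω] (L : SNLevy Ω)

/-- exit time -/
def T (a b : ℝ) (ω : Ω) : ℝ := TP (fun u => L.X u ω) a b

/-- position at exit -/
def V (a b : ℝ) (ω : Ω) : ℝ := XR (fun u => L.X u ω) (L.T a b ω)

theorem T_meas (a b : ℝ) : Measurable (L.T a b) := measurable_TP L.X a b L.measX

theorem V_meas (a b : ℝ) : Measurable (L.V a b) :=
  Measurable.comp (g := fun p : ℝ × Ω => XR (fun s => L.X s p.2) p.1)
    (f := fun ω => (L.T a b ω, ω)) (measurable_XR L.X L.measX) ((L.T_meas a b).prodMk measurable_id)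

theorem T_nonneg (a b : ℝ) (ω : Ω) : 0 ≤ L.T a b ω := TP_nonneg _ _ _

/-- stopped exponential -/
def N (a b l p t : ℝ) (ω : Ω) : ℝ :=
  (L.A a b t).indicator (L.M l p t) ω +
    (L.A a b t)ᶜ.indicator (fun ω => Real.exp (l * L.V a b ω - p * L.T a b ω)) ω

theorem Z_sq_bound (a b l p t : ℝ) (hl : 0 ≤ l) (ht : 0 ≤ t) (n : ℕ) :
    ∫ ω, L.Z a b l p t n ω ^ 2 ∂ L.P 0 ≤ 1 + |Real.exp ((L.ψ (2 * l) - 2 * p) * t) - 1| := by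
  have e : (fun ω => L.Z a b l p t n ω ^ 2) = L.Z a b (2 * l) (2 * p) t n := by
    funext ω
    obtain ⟨j, _, _, _, h⟩ := L.Z_spec a b t ht n ω
    rw [h, h, M_sq]
  rw [e, L.Z_integral a b (2 * l) (2 * p) t (by linarith) ht n]
  gcongr 1 + ?_
  set C := L.ψ (2 * l) - 2 * p
  have hn : (0 : ℝ) < (n : ℝ) + 1 := by positivity
  have hh : 0 ≤ t / ((n : ℝ) + 1) := by positivity
  rcases le_total 0 C with hC | hC
  · have h1 := Finset.sum_range_sub (fun k : ℕ => Real.exp (C * (k * (t / (n + 1))))) (n + 1)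
    have e2 : C * (((n + 1 : ℕ) : ℝ) * (t / (n + 1))) = C * t := by push_cast; field_simp
    rw [e2] at h1
    simp only [Nat.cast_zero, zero_mul, mul_zero, Real.exp_zero] at h1
    refine le_trans (le_trans ?_ h1.le) (le_abs_self _)
    refine Finset.sum_le_sum fun k _ => ?_
    push_cast
    refine mul_le_of_le_one_left ?_ (L.gg_le_one a b _ _ (by linarith) _)
    rw [sub_nonneg, Real.exp_le_exp]
    exact mul_le_mul_of_nonneg_left (by nlinarith) hC
  · refine le_trans (Finset.sum_nonpos fun k _ => ?_) (abs_nonneg _)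
    refine mul_nonpos_of_nonneg_of_nonpos (L.gg_nonneg _ _ _ _ _) ?_
    rw [sub_nonpos, Real.exp_le_exp]
    exact mul_le_mul_of_nonpos_left (by nlinarith) hC

theorem Z_lim (a b l p t : ℝ) (ht : 0 < t) :
    ∀ᵐ ω ∂ L.P 0, Tendsto (fun n => L.Z a b l p t n ω) atTop (nhds (L.N a b l p t ω)) := by
  filter_upwards [L.good] with ω hg
  have hh : ∀ n : ℕ, 0 < t / ((n : ℝ) + 1) := fun n => by positivity
  by_cases hA : ω ∈ L.A a b t
  · have : ∀ n, L.Z a b l p t n ω = L.M l p t ω := by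
      intro n
      obtain ⟨j, h1, h2, h3, h4⟩ := L.Z_spec a b t ht.le n ω
      have hn : (0 : ℝ) < (n : ℝ) + 1 := by positivity
      have hj : j = n + 1 := by
        by_contra hne
        have hlt : j < n + 1 := by omega
        refine h3 hlt (L.mem_A.2 (AP_mono ?_ (L.mem_A.1 hA)))
        rw [mul_div_assoc', div_le_iff₀ hn, mul_comm]
        gcongr
        exact_mod_cast hlt.le
      rw [h4, hj]; congr 1; push_cast; field_simp
    simp only [this, N, Set.indicator_of_mem hA, Set.indicator_of_notMem (Set.notMem_compl_iff.2 hA),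
      add_zero]
    exact tendsto_const_nhds
  · have hE : EX (fun u => L.X u ω) a b := ⟨t, hA⟩
    have hT : L.T a b ω < t := by
      have := (AP_iff hE t).not.1 hA
      push Not at this; exact this
    simp only [N, Set.indicator_of_notMem hA, Set.indicator_of_mem (Set.mem_compl hA), zero_add]
    choose j h1 h2 h3 h4 using fun n => L.Z_spec a b t ht.le n ω
    have hlow : ∀ n, L.T a b ω < j n * (t / (n + 1)) := by
      intro n
      rcases (h1 n).eq_or_lt with h | h
      · rw [h]; push_cast
        have hn : ((n : ℝ) + 1) ≠ 0 := by positivity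
        rw [mul_div_cancel₀ _ hn]; exact hT
      · have := (AP_iff hE _).not.1 (h3 n h)
        push Not at this; exact this
    have hup : ∀ n, j n * (t / (n + 1)) ≤ L.T a b ω + t / (n + 1) := by
      intro n
      rcases Nat.eq_zero_or_pos (j n) with h | h
      · rw [h]; have := L.T_nonneg a b ω; have := hh n; push_cast; linarith
      · have := (AP_iff hE _).1 (L.mem_A.1 (h2 n (j n - 1) (by omega)))
        rw [Nat.cast_sub h] at this
        push_cast at this
        have h5 : (((j n : ℝ) - 1) * (t / (n + 1))) ≤ L.T a b ω := this
        linarith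
    have hlim : Tendsto (fun n => j n * (t / ((n : ℝ) + 1))) atTop
        (nhdsWithin (L.T a b ω) (Set.Ioi (L.T a b ω))) := by
      refine tendsto_nhdsWithin_iff.2 ⟨?_, Eventually.of_forall hlow⟩
      have h5 : Tendsto (fun n : ℕ => L.T a b ω + t * (1 / ((n : ℝ) + 1))) atTop
          (nhds (L.T a b ω + t * 0)) :=
        tendsto_const_nhds.add (tendsto_one_div_add_atTop_nhds_zero_nat.const_mul t)
      rw [mul_zero, add_zero] at h5
      refine tendsto_of_tendsto_of_tendsto_of_le_of_le tendsto_const_nhds h5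
        (fun n => (hlow n).le) (fun n => ?_)
      have := hup n
      simp only [mul_one_div]; exact this
    simp only [h4]
    have hV : L.V a b ω = L.X (L.T a b ω) ω := hg.XR_eq _ (L.T_nonneg a b ω)
    rw [hV]
    unfold M
    refine (Real.continuous_exp.tendsto _).comp (Tendsto.sub ?_ ?_)
    · exact ((hg.rc _ (L.T_nonneg a b ω)).comp hlim).const_mul l
    · exact (hlim.mono_right nhdsWithin_le_nhds).const_mul p

theorem gg_integral_step (a b l p C u v : ℝ) (hl : 0 ≤ l) (huv : u ≤ v) (hu : 0 ≤ u) (t : ℝ)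
    (hvt : v ≤ t) :
    |L.gg a b l p u * (Real.exp (C * v) - Real.exp (C * u)) -
      ∫ s in u..v, L.gg a b l p s * (C * Real.exp (C * s))| ≤
    (L.gg a b l p u - L.gg a b l p v) * (|C| * Real.exp (|C| * t)) * (v - u) := by
  have hanti := L.gg_anti a b l p hl
  have hc : Continuous (fun s : ℝ => C * Real.exp (C * s)) := by fun_prop
  have hi : IntervalIntegrable (fun s => L.gg a b l p s * (C * Real.exp (C * s))) volume u v :=
    (hanti.intervalIntegrable).mul_continuousOn hc.continuousOn
  have h1 : ∫ s in u..v, C * Real.exp (C * s) = Real.exp (C * v) - Real.exp (C * u) := by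
    refine intervalIntegral.integral_eq_sub_of_hasDerivAt (f := fun s => Real.exp (C * s))
      (fun s _ => ?_) (hc.intervalIntegrable _ _)
    have := ((hasDerivAt_id s).const_mul C).exp
    simpa [mul_comm] using this
  rw [← h1, ← intervalIntegral.integral_const_mul, ← intervalIntegral.integral_sub
    ((hc.intervalIntegrable _ _).const_mul _) hi, ← Real.norm_eq_abs]
  rw [← abs_of_nonneg (sub_nonneg.2 huv)]
  refine intervalIntegral.norm_integral_le_of_norm_le_const fun s hs => ?_
  rw [Set.uIoc_of_le huv] at hs
  rw [← sub_mul, norm_mul, Real.norm_eq_abs, Real.norm_eq_abs, abs_mul, Real.abs_exp]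
  have h2 : L.gg a b l p s ≤ L.gg a b l p u := hanti hs.1.le
  have h3 : L.gg a b l p v ≤ L.gg a b l p s := hanti hs.2
  rw [abs_of_nonneg (sub_nonneg.2 h2)]
  have h4 : C * s ≤ |C| * t := by
    have h5 : 0 ≤ s := hu.trans hs.1.le
    exact (mul_le_mul_of_nonneg_right (le_abs_self C) h5).trans
      (mul_le_mul_of_nonneg_left (hs.2.trans hvt) (abs_nonneg C))
  gcongr
  linarith

theorem Z_integral_lim (a b l p t : ℝ) (hl : 0 ≤ l) (ht : 0 < t) :
    Tendsto (fun n => ∫ ω, L.Z a b l p t n ω ∂ L.P 0) atTop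
      (nhds (1 + ∫ s in (0 : ℝ)..t, L.gg a b l p s *
        ((L.ψ l - p) * Real.exp ((L.ψ l - p) * s)))) := by
  simp only [L.Z_integral a b l p t hl ht.le]
  set C := L.ψ l - p
  refine tendsto_const_nhds.add ?_
  have hlim : Tendsto (fun n : ℕ => (|C| * Real.exp (|C| * t) * t) * (1 / ((n : ℝ) + 1)))
      atTop (nhds 0) := by
    have := (tendsto_one_div_add_atTop_nhds_zero_nat (𝕜 := ℝ)).const_mul
      (|C| * Real.exp (|C| * t) * t)
    rwa [mul_zero] at this
  rw [tendsto_iff_dist_tendsto_zero]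
  refine squeeze_zero (fun _ => dist_nonneg) (fun n => ?_) hlim
  rw [Real.dist_eq]
  set h := t / ((n : ℝ) + 1) with hh
  have hn : (0 : ℝ) < (n : ℝ) + 1 := by positivity
  have hpos : 0 < h := by positivity
  have hK : ((n : ℝ) + 1) * h = t := by rw [hh]; field_simp
  have hc : Continuous (fun s : ℝ => C * Real.exp (C * s)) := by fun_prop
  have hsum : ∑ k ∈ Finset.range (n + 1), ∫ s in ((k : ℝ) * h)..((k + 1 : ℕ) : ℝ) * h,
      L.gg a b l p s * (C * Real.exp (C * s)) =
      ∫ s in (0 : ℝ)..t, L.gg a b l p s * (C * Real.exp (C * s)) := by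
    have := intervalIntegral.sum_integral_adjacent_intervals (μ := volume)
      (f := fun s => L.gg a b l p s * (C * Real.exp (C * s))) (a := fun k : ℕ => (k : ℝ) * h)
      (n := n + 1) (fun k _ =>
        (((L.gg_anti a b l p hl).intervalIntegrable).mul_continuousOn hc.continuousOn))
    rw [this]; push_cast; rw [zero_mul, hK]
  rw [← hsum, ← Finset.sum_sub_distrib]
  refine (Finset.abs_sum_le_sum_abs _ _).trans ?_
  have hstep : ∀ k ∈ Finset.range (n + 1), |L.gg a b l p ((k : ℝ) * h) *
      (Real.exp (C * (((k : ℝ) + 1) * h)) - Real.exp (C * ((k : ℝ) * h))) -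
      ∫ s in ((k : ℝ) * h)..((k + 1 : ℕ) : ℝ) * h, L.gg a b l p s * (C * Real.exp (C * s))| ≤
      (|C| * Real.exp (|C| * t) * h) *
        (L.gg a b l p ((k : ℝ) * h) - L.gg a b l p (((k + 1 : ℕ) : ℝ) * h)) := by
    intro k hk
    have hk' : (k : ℝ) + 1 ≤ (n : ℝ) + 1 := by
      have := Finset.mem_range.1 hk
      exact_mod_cast this
    have := L.gg_integral_step a b l p C ((k : ℝ) * h) (((k : ℝ) + 1) * h) hl (by nlinarith)
      (by positivity) t (by rw [← hK]; gcongr)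
    push_cast
    refine this.trans (le_of_eq ?_)
    ring
  refine (Finset.sum_le_sum hstep).trans ?_
  rw [← Finset.mul_sum, Finset.sum_range_sub' (fun k : ℕ => L.gg a b l p ((k : ℝ) * h))]
  have h1 : L.gg a b l p (((0 : ℕ) : ℝ) * h) - L.gg a b l p (((n + 1 : ℕ) : ℝ) * h) ≤ 1 := by
    have := L.gg_le_one a b l p hl (((0 : ℕ) : ℝ) * h)
    have := L.gg_nonneg a b l p (((n + 1 : ℕ) : ℝ) * h)
    linarith
  calc _ ≤ |C| * Real.exp (|C| * t) * h * 1 := by gcongr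
    _ = _ := by rw [hh]; ring

theorem N_le (a b l p t : ℝ) (hb : 0 ≤ b) (hl : 0 ≤ l) (hp : 0 ≤ p) (ht : 0 ≤ t) :
    ∀ᵐ ω ∂ L.P 0, L.N a b l p t ω ≤ Real.exp (l * b) := by
  filter_upwards [L.good] with ω hg
  by_cases hA : ω ∈ L.A a b t
  · simp only [N, Set.indicator_of_mem hA, Set.indicator_of_notMem (Set.notMem_compl_iff.2 hA),
      add_zero, M]
    rw [Real.exp_le_exp]
    have h1 := hg.le_of_AP hb (L.mem_A.1 hA) ht
    have := mul_le_mul_of_nonneg_left h1 hl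
    have := mul_nonneg hp ht
    linarith
  · have hE : EX (fun u => L.X u ω) a b := ⟨t, hA⟩
    simp only [N, Set.indicator_of_notMem hA, Set.indicator_of_mem (Set.mem_compl hA), zero_add]
    have hV : L.V a b ω = L.X (L.T a b ω) ω := hg.XR_eq _ (L.T_nonneg a b ω)
    rw [hV, Real.exp_le_exp]
    have h1 : L.X (L.T a b ω) ω ≤ b := hg.TP_le hb hE
    have := mul_le_mul_of_nonneg_left h1 hl
    have := mul_nonneg hp (L.T_nonneg a b ω)
    linarith

theorem dynkin (a b l p t : ℝ) (hb : 0 ≤ b) (hl : 0 ≤ l) (hp : 0 ≤ p) (ht : 0 < t) :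
    ∫ ω, L.N a b l p t ω ∂ L.P 0 = 1 + ∫ s in (0 : ℝ)..t, L.gg a b l p s *
        ((L.ψ l - p) * Real.exp ((L.ψ l - p) * s)) := by
  have := L.probP 0
  refine tendsto_nhds_unique ?_ (L.Z_integral_lim a b l p t hl ht)
  refine tendsto_integral_of_sq_bound (L.P 0) (fun n => L.Z a b l p t n) (L.N a b l p t)
    (1 + |Real.exp ((L.ψ (2 * l) - 2 * p) * t) - 1|) (Real.exp (l * b))
    (L.Z_int a b l p t hl ht.le) ?_ (L.Z_sq_bound a b l p t hl ht.le) ?_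
    (L.N_le a b l p t hb hl hp ht.le) (L.Z_lim a b l p t ht)
  · intro n
    have e : (fun ω => L.Z a b l p t n ω ^ 2) = L.Z a b (2 * l) (2 * p) t n := by
      funext ω
      obtain ⟨j, _, _, _, h⟩ := L.Z_spec a b t ht.le n ω
      rw [h, h, M_sq]
    rw [e]
    exact L.Z_int a b (2 * l) (2 * p) t (by linarith) ht.le n
  · intro n ω
    obtain ⟨j, _, _, _, h⟩ := L.Z_spec a b t ht.le n ω
    rw [h]; exact (L.M_pos _ _ _ _).le

end SNLevy


namespace SNLevy

variable {Ω : Type} [MeasurableSpace Ω] (L : SNLevy Ω)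

theorem N_meas (a b l p t : ℝ) : Measurable (L.N a b l p t) := by
  refine ((L.M_meas l p t).indicator (L.A_meas a b t)).add (Measurable.indicator ?_ (L.A_meas a b t).compl)
  exact Real.measurable_exp.comp (((L.V_meas a b).const_mul l).sub ((L.T_meas a b).const_mul p))

theorem N_nonneg (a b l p t : ℝ) (ω : Ω) : 0 ≤ L.N a b l p t ω :=
  add_nonneg (Set.indicator_nonneg (fun ω _ => (L.M_pos l p t ω).le) _)
    (Set.indicator_nonneg (fun _ _ => (Real.exp_pos _).le) _)

theorem phi_int (a b l p t : ℝ) (hl : 0 ≤ l) (ht : 0 < t) :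
    IntegrableOn (L.phi a b l p) (Set.Ioc 0 t) := by
  have hc : Continuous (fun s : ℝ => Real.exp ((L.ψ l - p) * s)) := by fun_prop
  have h1 : IntervalIntegrable (fun s => L.gg a b l p s * Real.exp ((L.ψ l - p) * s)) volume 0 t :=
    ((L.gg_anti a b l p hl).intervalIntegrable).mul_continuousOn hc.continuousOn
  rw [intervalIntegrable_iff_integrableOn_Ioc_of_le ht.le] at h1
  exact h1.congr_fun (fun s hs => (L.phi_eq a b l p s hs.1.le).symm) measurableSet_Ioc

theorem dynkin_l (a b l p t : ℝ) (hb : 0 ≤ b) (hl : 0 ≤ l) (hp : 0 ≤ p) (ht : 0 < t)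
    (hC : p ≤ L.ψ l) :
    ∫⁻ ω, ENNReal.ofReal (L.N a b l p t ω) ∂ L.P 0 =
      1 + ENNReal.ofReal (L.ψ l - p) * ∫⁻ s in Set.Ioc 0 t, ENNReal.ofReal (L.phi a b l p s) := by
  have := L.probP 0
  have hNi : Integrable (L.N a b l p t) (L.P 0) := by
    refine Integrable.of_bound (L.N_meas a b l p t).aestronglyMeasurable (Real.exp (l * b)) ?_
    filter_upwards [L.N_le a b l p t hb hl hp ht.le] with ω h
    rwa [Real.norm_of_nonneg (L.N_nonneg a b l p t ω)]
  rw [← ofReal_integral_eq_lintegral_ofReal hNi (Eventually.of_forall (L.N_nonneg a b l p t)),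
    L.dynkin a b l p t hb hl hp ht, ← ofReal_integral_eq_lintegral_ofReal
      (L.phi_int a b l p t hl ht) (Eventually.of_forall (L.phi_nonneg a b l p)),
    ← ENNReal.ofReal_mul (by linarith), ← ENNReal.ofReal_one, ← ENNReal.ofReal_add (by norm_num)]
  · congr 2
    rw [intervalIntegral.integral_of_le ht.le, ← integral_const_mul]
    refine setIntegral_congr_fun measurableSet_Ioc fun s hs => ?_
    rw [L.phi_eq a b l p s hs.1.le]; ring
  · exact mul_nonneg (by linarith) (integral_nonneg (L.phi_nonneg a b l p))

theorem A_bound (a b l t : ℝ) (hb : 0 ≤ b) (hl : 0 ≤ l) (ht : 0 < t) (hC : 0 < L.ψ l) :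
    ENNReal.ofReal (L.ψ l * Real.exp (-(l * a)) * t) * L.P 0 (L.A a b t) ≤
      ENNReal.ofReal (Real.exp (l * b)) := by
  have := L.probP 0
  have h1 := L.dynkin_l a b l 0 t hb hl le_rfl ht hC.le
  have h2 : ∫⁻ ω, ENNReal.ofReal (L.N a b l 0 t ω) ∂ L.P 0 ≤ ENNReal.ofReal (Real.exp (l * b)) := by
    calc _ ≤ ∫⁻ ω, ENNReal.ofReal (Real.exp (l * b)) ∂ L.P 0 := by
          refine lintegral_mono_ae ?_
          filter_upwards [L.N_le a b l 0 t hb hl le_rfl ht.le] with ω h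
          exact ENNReal.ofReal_le_ofReal h
      _ = _ := by simp
  rw [h1, sub_zero] at h2
  refine le_trans ?_ (le_trans le_add_self h2)
  rw [ENNReal.ofReal_mul (by positivity), ENNReal.ofReal_mul hC.le, mul_assoc, mul_assoc]
  gcongr
  have h3 : ∀ s ∈ Set.Ioo 0 t, ENNReal.ofReal (Real.exp (-(l * a))) * L.P 0 (L.A a b t) ≤
      ENNReal.ofReal (L.phi a b l 0 s) := by
    intro s hs
    unfold phi
    rw [ofReal_integral_eq_lintegral_ofReal (L.M_int l 0 s hl hs.1.le).integrableOn
      (Eventually.of_forall fun ω => (L.M_pos l 0 s ω).le), ← setLIntegral_const]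
    refine le_trans ?_ (lintegral_mono_set (s := L.A a b t)
      (fun ω hω => L.mem_A.2 (AP_mono hs.2.le (L.mem_A.1 hω))))
    refine setLIntegral_mono_ae' (L.A_meas a b t) ?_
    filter_upwards [L.good] with ω hg hω
    refine ENNReal.ofReal_le_ofReal ?_
    unfold M
    rw [Real.exp_le_exp]
    have := (hg.mem_of_lt (L.mem_A.1 hω) hs.1.le hs.2).1
    have := mul_le_mul_of_nonneg_left this hl
    linarith
  calc _ = ∫⁻ s in Set.Ioo 0 t, ENNReal.ofReal (Real.exp (-(l * a))) * L.P 0 (L.A a b t) := by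
        rw [setLIntegral_const, Real.volume_Ioo, sub_zero]; ring
    _ ≤ ∫⁻ s in Set.Ioo 0 t, ENNReal.ofReal (L.phi a b l 0 s) :=
        setLIntegral_mono' measurableSet_Ioo h3
    _ ≤ _ := lintegral_mono_set Set.Ioo_subset_Ioc_self

theorem EX_ae (a b l : ℝ) (hb : 0 ≤ b) (hl : 0 ≤ l) (hC : 0 < L.ψ l) :
    ∀ᵐ ω ∂ L.P 0, EX (fun u => L.X u ω) a b := by
  have := L.probP 0
  have hz : L.P 0 (⋂ n : ℕ, L.A a b (n + 1)) = 0 := by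
    by_contra hne
    set c := L.P 0 (⋂ n : ℕ, L.A a b (n + 1)) with hc
    have hct : c ≠ ⊤ := measure_ne_top _ _
    have hcp : 0 < c.toReal := ENNReal.toReal_pos hne hct
    have hk : 0 < L.ψ l * Real.exp (-(l * a)) := by positivity
    have hb : ∀ n : ℕ, L.ψ l * Real.exp (-(l * a)) * (n + 1) * c.toReal ≤ Real.exp (l * b) := by
      intro n
      have h1 := L.A_bound a b l (n + 1) hb hl (by positivity) hC
      have h2 : c ≤ L.P 0 (L.A a b (n + 1)) := measure_mono (Set.iInter_subset _ n)
      have h3 := (mul_le_mul_right h2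
        (ENNReal.ofReal (L.ψ l * Real.exp (-(l * a)) * (n + 1)))).trans h1
      rw [← ENNReal.ofReal_toReal hct, ← ENNReal.ofReal_mul (by positivity)] at h3
      exact (ENNReal.ofReal_le_ofReal_iff (Real.exp_pos _).le).1 h3
    obtain ⟨n, hn⟩ := exists_nat_gt (Real.exp (l * b) / (L.ψ l * Real.exp (-(l * a)) * c.toReal))
    rw [div_lt_iff₀ (by positivity)] at hn
    have := hb n
    have : 0 < L.ψ l * Real.exp (-(l * a)) * c.toReal := by positivity
    nlinarith
  have : ∀ᵐ ω ∂ L.P 0, ω ∉ ⋂ n : ℕ, L.A a b (n + 1) := measure_eq_zero_iff_ae_notMem.1 hz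
  filter_upwards [this] with ω hω
  rw [Set.mem_iInter, not_forall] at hω
  obtain ⟨n, hn⟩ := hω
  exact ⟨n + 1, hn⟩

theorem transform0 (a b l p : ℝ) (hb : 0 ≤ b) (hl : 0 ≤ l) (hp : 0 ≤ p) (hC : p < L.ψ l) :
    ∫⁻ ω, ENNReal.ofReal (Real.exp (l * L.V a b ω - p * L.T a b ω)) ∂ L.P 0 =
      1 + ENNReal.ofReal (L.ψ l - p) * ∫⁻ s in Set.Ioi 0, ENNReal.ofReal (L.phi a b l p s) := by
  have := L.probP 0
  have h1 : Tendsto (fun n : ℕ => ∫⁻ ω, ENNReal.ofReal (L.N a b l p (n + 1) ω) ∂ L.P 0) atTop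
      (nhds (∫⁻ ω, ENNReal.ofReal (Real.exp (l * L.V a b ω - p * L.T a b ω)) ∂ L.P 0)) := by
    refine tendsto_lintegral_of_dominated_convergence (fun _ => ENNReal.ofReal (Real.exp (l * b)))
      (fun n => (L.N_meas a b l p _).ennreal_ofReal) ?_ (by simp) ?_
    · intro n
      filter_upwards [L.N_le a b l p (n + 1) hb hl hp (by positivity)] with ω h
      exact ENNReal.ofReal_le_ofReal h
    · filter_upwards [L.EX_ae a b l hb hl (hp.trans_lt hC)] with ω hE
      refine tendsto_const_nhds.congr' ?_
      obtain ⟨s, hs⟩ := hE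
      obtain ⟨m, hm⟩ := exists_nat_ge s
      filter_upwards [eventually_ge_atTop m] with n hn
      have hA : ω ∉ L.A a b (n + 1) := by
        intro h
        refine hs (AP_mono ?_ (L.mem_A.1 h))
        have : (m : ℝ) ≤ n := by exact_mod_cast hn
        linarith
      simp only [N, Set.indicator_of_notMem hA, Set.indicator_of_mem (Set.mem_compl hA), zero_add]
  have h2 : Tendsto (fun n : ℕ => ∫⁻ s in Set.Ioc (0 : ℝ) (n + 1), ENNReal.ofReal (L.phi a b l p s))
      atTop (nhds (∫⁻ s in Set.Ioi 0, ENNReal.ofReal (L.phi a b l p s))) := by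
    have hm : Monotone (fun n : ℕ => Set.Ioc (0 : ℝ) (n + 1)) := fun m n h =>
      Set.Ioc_subset_Ioc_right (by simpa using h)
    have e : Set.Ioi (0 : ℝ) = ⋃ n : ℕ, Set.Ioc (0 : ℝ) (n + 1) := by
      ext s
      simp only [Set.mem_Ioi, Set.mem_iUnion, Set.mem_Ioc]
      constructor
      · intro h
        obtain ⟨n, hn⟩ := exists_nat_ge s
        exact ⟨n, h, by linarith⟩
      · rintro ⟨n, h, _⟩; exact h
    rw [e, setLIntegral_iUnion_of_directed _ hm.directed_le]
    exact tendsto_atTop_iSup fun m n h => lintegral_mono_set (hm h)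
  refine tendsto_nhds_unique h1 ?_
  simp only [fun n : ℕ => L.dynkin_l a b l p (n + 1) hb hl hp (by positivity) hC.le]
  exact tendsto_const_nhds.add (ENNReal.Tendsto.const_mul h2 (Or.inr ENNReal.ofReal_ne_top))

/-- law at exit, discounted -/
def mu (a b q : ℝ) : Measure ℝ :=
  ((L.P 0).withDensity fun ω => ENNReal.ofReal (Real.exp (-q * L.T a b ω))).map (L.V a b)

theorem mu_lintegral (a b q : ℝ) (f : ℝ → ℝ≥0∞) (hf : Measurable f) :
    ∫⁻ z, f z ∂ L.mu a b q =
      ∫⁻ ω, ENNReal.ofReal (Real.exp (-q * L.T a b ω)) * f (L.V a b ω) ∂ L.P 0 := by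
  unfold mu
  have hd : Measurable (fun ω => ENNReal.ofReal (Real.exp (-q * L.T a b ω))) :=
    (Real.measurable_exp.comp ((L.T_meas a b).const_mul _)).ennreal_ofReal
  rw [lintegral_map hf (L.V_meas a b)]
  exact lintegral_withDensity_eq_lintegral_mul _ hd (hf.comp (L.V_meas a b))

/-- discounted occupation measure before exit -/
def R (a b q : ℝ) : Measure ℝ :=
  (((volume.restrict (Set.Ioi (0 : ℝ))).prod (L.P 0)).withDensity
    ({p : ℝ × Ω | AP (fun u => L.X u p.2) a b p.1}.indicator
      fun p => ENNReal.ofReal (Real.exp (-q * p.1)))).map (fun p => XR (fun s => L.X s p.2) p.1)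

theorem R_lintegral (a b q : ℝ) (f : ℝ → ℝ≥0∞) (hf : Measurable f) :
    ∫⁻ z, f z ∂ L.R a b q = ∫⁻ s in Set.Ioi (0 : ℝ), ∫⁻ ω in L.A a b s,
      ENNReal.ofReal (Real.exp (-q * s)) * f (L.X s ω) ∂ L.P 0 := by
  have := L.probP 0
  have hXR := measurable_XR L.X L.measX
  have hAP := measurableSet_AP_prod L.X a b L.measX
  have hd : Measurable ({p : ℝ × Ω | AP (fun u => L.X u p.2) a b p.1}.indicator
      fun p => ENNReal.ofReal (Real.exp (-q * p.1))) :=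
    Measurable.indicator (by fun_prop) hAP
  unfold R
  rw [lintegral_map hf hXR]
  refine (lintegral_withDensity_eq_lintegral_mul _ hd (hf.comp hXR)).trans ?_
  rw [lintegral_prod _ (hd.mul (hf.comp hXR)).aemeasurable]
  refine setLIntegral_congr_fun measurableSet_Ioi fun s hs => ?_
  rw [← lintegral_indicator (L.A_meas a b s)]
  refine lintegral_congr_ae ?_
  filter_upwards [L.good] with ω hg
  have e : XR (fun s => L.X s ω) s = L.X s ω := hg.XR_eq s (le_of_lt hs)
  by_cases hA : ω ∈ L.A a b s
  · simp only [Pi.mul_apply, Set.indicator_of_mem hA]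
    rw [Set.indicator_of_mem (show (s, ω) ∈ {p : ℝ × Ω | AP (fun u => L.X u p.2) a b p.1} from hA)]
    simp only [Function.comp, e]
  · simp only [Pi.mul_apply, Set.indicator_of_notMem hA]
    rw [Set.indicator_of_notMem
      (show (s, ω) ∉ {p : ℝ × Ω | AP (fun u => L.X u p.2) a b p.1} from hA), zero_mul]

theorem mu_hat (a b l q : ℝ) : ∫⁻ z, ENNReal.ofReal (Real.exp (l * z)) ∂ L.mu a b q =
    ∫⁻ ω, ENNReal.ofReal (Real.exp (l * L.V a b ω - q * L.T a b ω)) ∂ L.P 0 := by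
  rw [L.mu_lintegral a b q _ (by fun_prop)]
  refine lintegral_congr fun ω => ?_
  rw [← ENNReal.ofReal_mul (Real.exp_pos _).le, ← Real.exp_add]
  congr 2; ring

theorem R_hat (a b l q : ℝ) (hl : 0 ≤ l) : ∫⁻ z, ENNReal.ofReal (Real.exp (l * z)) ∂ L.R a b q =
    ∫⁻ s in Set.Ioi 0, ENNReal.ofReal (L.phi a b l q s) := by
  rw [L.R_lintegral a b q _ (by fun_prop)]
  refine setLIntegral_congr_fun measurableSet_Ioi fun s hs => ?_
  unfold phi
  rw [ofReal_integral_eq_lintegral_ofReal (L.M_int l q s hl (le_of_lt hs)).integrableOn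
      (Eventually.of_forall fun ω => (L.M_pos l q s ω).le)]
  refine lintegral_congr fun ω => ?_
  rw [← ENNReal.ofReal_mul (Real.exp_pos _).le, ← Real.exp_add]
  unfold M
  congr 2; ring

theorem hat_eq (a b l q : ℝ) (hb : 0 ≤ b) (hl : 0 ≤ l) (hq : 0 ≤ q) (hC : q < L.ψ l) :
    ∫⁻ z, ENNReal.ofReal (Real.exp (l * z)) ∂ L.mu a b q =
      1 + ENNReal.ofReal (L.ψ l - q) * ∫⁻ z, ENNReal.ofReal (Real.exp (l * z)) ∂ L.R a b q := by
  rw [mu_hat, R_hat _ _ _ _ _ hl, L.transform0 a b l q hb hl hq hC]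

theorem mu_supp (a b l q : ℝ) (hb : 0 ≤ b) (hl : 0 ≤ l) (hC : 0 < L.ψ l) :
    ∀ᵐ z ∂ L.mu a b q, z ≤ -a ∨ z = b := by
  unfold mu
  have hm : MeasurableSet {z : ℝ | z ≤ -a ∨ z = b} :=
    measurableSet_Iic.union (measurableSet_singleton b)
  rw [ae_map_iff (L.V_meas a b).aemeasurable hm]
  refine (withDensity_absolutelyContinuous _ _).ae_le ?_
  filter_upwards [L.good, L.EX_ae a b l hb hl hC] with ω hg hE
  have hV : L.V a b ω = L.X (L.T a b ω) ω := hg.XR_eq _ (L.T_nonneg a b ω)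
  rw [hV]
  exact hg.TP_or hb hE

theorem R_supp (a b l q : ℝ) (hb : 0 ≤ b) (hl : 0 ≤ l) (hC : 0 < L.ψ l) :
    ∀ᵐ z ∂ L.R a b q, -a ≤ z ∧ z ≤ b := by
  have := L.probP 0
  have hXR := measurable_XR L.X L.measX
  have hAP := measurableSet_AP_prod L.X a b L.measX
  have hd : Measurable ({p : ℝ × Ω | AP (fun u => L.X u p.2) a b p.1}.indicator
      fun p => ENNReal.ofReal (Real.exp (-q * p.1))) :=
    Measurable.indicator (by fun_prop) hAP
  have hI : MeasurableSet {z : ℝ | -a ≤ z ∧ z ≤ b} := measurableSet_Icc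
  unfold R
  rw [ae_map_iff hXR.aemeasurable hI, ae_withDensity_iff hd]
  have hset : MeasurableSet {p : ℝ × Ω | AP (fun u => L.X u p.2) a b p.1 →
      (-a ≤ XR (fun s => L.X s p.2) p.1 ∧ XR (fun s => L.X s p.2) p.1 ≤ b)} := by
    have : {p : ℝ × Ω | AP (fun u => L.X u p.2) a b p.1 →
      (-a ≤ XR (fun s => L.X s p.2) p.1 ∧ XR (fun s => L.X s p.2) p.1 ≤ b)} =
      {p : ℝ × Ω | AP (fun u => L.X u p.2) a b p.1}ᶜ ∪
        (fun p : ℝ × Ω => XR (fun s => L.X s p.2) p.1) ⁻¹' {z : ℝ | -a ≤ z ∧ z ≤ b} := by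
      ext p; simp [imp_iff_not_or]
    rw [this]
    exact hAP.compl.union (hXR hI)
  have key : ∀ᵐ p ∂ (volume.restrict (Set.Ioi (0 : ℝ))).prod (L.P 0),
      AP (fun u => L.X u p.2) a b p.1 →
      (-a ≤ XR (fun s => L.X s p.2) p.1 ∧ XR (fun s => L.X s p.2) p.1 ≤ b) := by
    rw [Measure.ae_prod_iff_ae_ae hset, Measure.ae_ae_comm hset]
    filter_upwards [L.good, L.EX_ae a b l hb hl hC] with ω hg hE
    have h1 : ∀ᵐ s ∂ (volume.restrict (Set.Ioi (0 : ℝ))), s ≠ TP (fun u => L.X u ω) a b :=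
      ae_restrict_of_ae (measure_eq_zero_iff_ae_notMem.1 (measure_singleton _))
    filter_upwards [h1, ae_restrict_mem measurableSet_Ioi] with s hs hs0 hA
    have hlt : s < TP (fun u => L.X u ω) a b := lt_of_le_of_ne ((AP_iff hE s).1 hA) hs
    rw [hg.XR_eq s (le_of_lt hs0)]
    exact hg.mem_of_lt ((AP_iff hE _).2 le_rfl) (le_of_lt hs0) hlt
  filter_upwards [key] with p hp hne
  refine hp ?_
  by_contra h
  exact hne (Set.indicator_of_notMem (by exact h) _)

theorem mu_finite (a b q : ℝ) (hq : 0 ≤ q) : IsFiniteMeasure (L.mu a b q) := by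
  have := L.probP 0
  refine ⟨?_⟩
  have h : L.mu a b q Set.univ = ∫⁻ z, 1 ∂ L.mu a b q := by simp
  rw [h, L.mu_lintegral a b q _ measurable_const]
  refine lt_of_le_of_lt (lintegral_mono (g := fun _ => 1) fun ω => ?_) (by simp)
  simp only [mul_one]
  rw [ENNReal.ofReal_le_one, Real.exp_le_one_iff]
  have := mul_nonneg hq (L.T_nonneg a b ω)
  linarith

theorem R_hat_fin (a b l q : ℝ) (hb : 0 ≤ b) (hl : 0 ≤ l) (hq : 0 ≤ q) (hC : q < L.ψ l) :
    ∫⁻ z, ENNReal.ofReal (Real.exp (l * z)) ∂ L.R a b q ≠ ⊤ := by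
  have h1 := L.hat_eq a b l q hb hl hq hC
  have := L.mu_finite a b q hq
  have h2 : ∫⁻ z, ENNReal.ofReal (Real.exp (l * z)) ∂ L.mu a b q ≠ ⊤ := by
    have h3 : ∫⁻ z, ENNReal.ofReal (Real.exp (l * z)) ∂ L.mu a b q ≤
        ∫⁻ z, ENNReal.ofReal (max (Real.exp (l * (-a))) (Real.exp (l * b))) ∂ L.mu a b q := by
      refine lintegral_mono_ae ?_
      filter_upwards [L.mu_supp a b l q hb hl (hq.trans_lt hC)] with z hz
      refine ENNReal.ofReal_le_ofReal ?_
      rcases hz with h | rfl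
      · exact le_max_of_le_left (Real.exp_le_exp.2 (mul_le_mul_of_nonneg_left h hl))
      · exact le_max_right _ _
    refine (lt_of_le_of_lt h3 ?_).ne
    rw [lintegral_const]
    exact ENNReal.mul_lt_top ENNReal.ofReal_lt_top (measure_lt_top _ _)
  rw [h1] at h2
  intro h
  rw [h, ENNReal.mul_top (by simpa using hC)] at h2
  simp at h2

theorem R_finite (a b l q : ℝ) (hb : 0 ≤ b) (hl : 0 ≤ l) (hq : 0 ≤ q) (hC : q < L.ψ l) :
    IsFiniteMeasure (L.R a b q) := by
  refine ⟨?_⟩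
  have h1 := L.R_hat_fin a b l q hb hl hq hC
  have h2 : ENNReal.ofReal (Real.exp (l * -a)) * L.R a b q Set.univ ≤
      ∫⁻ z, ENNReal.ofReal (Real.exp (l * z)) ∂ L.R a b q := by
    rw [← lintegral_const]
    refine lintegral_mono_ae ?_
    filter_upwards [L.R_supp a b l q hb hl (hq.trans_lt hC)] with z hz
    exact ENNReal.ofReal_le_ofReal (Real.exp_le_exp.2 (mul_le_mul_of_nonneg_left hz.1 hl))
  have h3 := lt_of_le_of_lt h2 (lt_top_iff_ne_top.2 h1)
  rw [lt_top_iff_ne_top]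
  intro h
  rw [h, ENNReal.mul_top (by simpa using Real.exp_pos _)] at h3
  exact lt_irrefl _ h3

end SNLevy


theorem freq_ae_right {p : ℝ → Prop} {u v : ℝ} (huv : u < v)
    (h : ∀ᵐ x : ℝ, x ∈ Set.Ioo u v → p x) : ∃ᶠ x in nhdsWithin u (Set.Ioi u), p x := by
  have hz : volume {x | ¬ (x ∈ Set.Ioo u v → p x)} = 0 := ae_iff.1 h
  intro hn
  obtain ⟨w, hw, hsub⟩ := (mem_nhdsGT_iff_exists_Ioo_subset).1 hn
  have h0 : volume (Set.Ioo u (min w v)) = 0 := by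
    refine measure_mono_null (fun x hx => ?_) hz
    · intro hc
      exact hsub ⟨hx.1, hx.2.trans_le (min_le_left _ _)⟩ (hc ⟨hx.1, hx.2.trans_le (min_le_right _ _)⟩)
  rw [Real.volume_Ioo, ENNReal.ofReal_eq_zero] at h0
  have : u < min w v := lt_min hw huv
  linarith

theorem freq_ae_left {p : ℝ → Prop} {u v : ℝ} (huv : u < v)
    (h : ∀ᵐ x : ℝ, x ∈ Set.Ioo u v → p x) : ∃ᶠ x in nhdsWithin v (Set.Iio v), p x := by
  have hz : volume {x | ¬ (x ∈ Set.Ioo u v → p x)} = 0 := ae_iff.1 h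
  intro hn
  obtain ⟨w, hw, hsub⟩ := (mem_nhdsLT_iff_exists_Ioo_subset).1 hn
  have h0 : volume (Set.Ioo (max w u) v) = 0 := by
    refine measure_mono_null (fun x hx => ?_) hz
    · intro hc
      exact hsub ⟨(le_max_left _ _).trans_lt hx.1, hx.2⟩ (hc ⟨(le_max_right _ _).trans_lt hx.1, hx.2⟩)
  rw [Real.volume_Ioo, ENNReal.ofReal_eq_zero] at h0
  have : max w u < v := max_lt hw huv
  linarith

/-- convolution density -/
def kc (k : ℝ → ℝ≥0∞) (μ : Measure ℝ) (x : ℝ) : ℝ≥0∞ := ∫⁻ z, k (z - x) ∂μ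

theorem kc_meas {k : ℝ → ℝ≥0∞} (hk : Measurable k) (μ : Measure ℝ) [SFinite μ] :
    Measurable (kc k μ) := by
  unfold kc
  exact Measurable.lintegral_prod_right' (f := fun p : ℝ × ℝ => k (p.2 - p.1))
    (hk.comp (measurable_snd.sub measurable_fst))

theorem kc_hat {k : ℝ → ℝ≥0∞} (hk : Measurable k) (μ : Measure ℝ) [SFinite μ] (l : ℝ) :
    ∫⁻ x, ENNReal.ofReal (Real.exp (l * x)) ∂ (volume.withDensity (kc k μ)) =
      (∫⁻ z, ENNReal.ofReal (Real.exp (l * z)) ∂μ) *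
        ∫⁻ y, k y * ENNReal.ofReal (Real.exp (-l * y)) := by
  have he : Measurable (fun x : ℝ => ENNReal.ofReal (Real.exp (l * x))) := by fun_prop
  rw [lintegral_withDensity_eq_lintegral_mul _ (kc_meas hk μ) he]
  have h1 : ∀ x, (kc k μ * fun x => ENNReal.ofReal (Real.exp (l * x))) x =
      ∫⁻ z, k (z - x) * ENNReal.ofReal (Real.exp (l * x)) ∂μ := by
    intro x
    have hm : Measurable (fun z => k (z - x)) := hk.comp (measurable_id.sub_const x)
    exact (lintegral_mul_const _ hm).symm
  simp only [h1]
  rw [lintegral_lintegral_swap (by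
    have : Measurable (fun p : ℝ × ℝ => k (p.2 - p.1) * ENNReal.ofReal (Real.exp (l * p.1))) :=
      (hk.comp (measurable_snd.sub measurable_fst)).mul (he.comp measurable_fst)
    exact this.aemeasurable)]
  rw [← lintegral_mul_const _ he]
  refine lintegral_congr fun z => ?_
  have hm : Measurable (fun y : ℝ => k y * ENNReal.ofReal (Real.exp (-l * y))) := by fun_prop
  rw [← lintegral_const_mul _ hm]
  rw [← lintegral_sub_left_eq_self (fun y => ENNReal.ofReal (Real.exp (l * z)) *
    (k y * ENNReal.ofReal (Real.exp (-l * y)))) z]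
  refine lintegral_congr fun x => ?_
  rw [mul_left_comm, ← ENNReal.ofReal_mul (Real.exp_pos _).le, ← Real.exp_add]
  congr 3; ring

namespace SNLevy

variable {Ω : Type} [MeasurableSpace Ω] (L : SNLevy Ω)

/-- extended scale function -/
def w (q : ℝ) (y : ℝ) : ℝ≥0∞ := ENNReal.ofReal (L.W q y)

theorem w_meas (q : ℝ) (hq : 0 ≤ q) : Measurable (L.w q) := (L.Wmeas q hq).ennreal_ofReal

theorem w_neg (q : ℝ) (hq : 0 ≤ q) (y : ℝ) (hy : y < 0) : L.w q y = 0 := by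
  simp [w, L.Wzero q hq y hy]

theorem w_hat (q : ℝ) (hq : 0 ≤ q) (l : ℝ) (h1 : L.Φ q < l) (h2 : q < L.ψ l) :
    ∫⁻ y, L.w q y * ENNReal.ofReal (Real.exp (-l * y)) = ENNReal.ofReal (1 / (L.ψ l - q)) := by
  rw [← L.Wlaplace q hq l h1, ofReal_integral_eq_lintegral_ofReal (L.W_int q hq l h1 h2)
    (Eventually.of_forall fun y => mul_nonneg (Real.exp_pos _).le (L.Wnonneg q hq y)),
    ← lintegral_indicator measurableSet_Ioi]
  refine lintegral_congr_ae ?_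
  have h0 : ∀ᵐ y : ℝ, y ≠ 0 := measure_eq_zero_iff_ae_notMem.1 (measure_singleton _)
  filter_upwards [h0] with y hy
  rcases lt_or_gt_of_ne hy with h | h
  · rw [L.w_neg q hq y h, Set.indicator_of_notMem (by simpa using h.le), zero_mul]
  · rw [Set.indicator_of_mem (by exact h), mul_comm, w, ← ENNReal.ofReal_mul (Real.exp_pos _).le]

theorem R_fin (hBVσ : L.σ2 = 0)
    (hBVPi : ∫⁻ y in Set.Ioo (-1 : ℝ) 0, ENNReal.ofReal (-y) ∂ L.levyMeasure ≠ ⊤)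
    (a b q : ℝ) (hb : 0 ≤ b) (hq : 0 ≤ q) : IsFiniteMeasure (L.R a b q) := by
  obtain ⟨l₀, h0, h⟩ := L.exists_large hBVσ hBVPi q
  obtain ⟨h1, h2, h3⟩ := h (l₀ + 1) (by linarith)
  exact L.R_finite a b _ q hb h1.le hq h3

theorem exists_pos (hBVσ : L.σ2 = 0)
    (hBVPi : ∫⁻ y in Set.Ioo (-1 : ℝ) 0, ENNReal.ofReal (-y) ∂ L.levyMeasure ≠ ⊤) :
    ∃ l, 0 ≤ l ∧ 0 < L.ψ l := by
  obtain ⟨l₀, h0, h⟩ := L.exists_large hBVσ hBVPi 0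
  obtain ⟨h1, h2, h3⟩ := h (l₀ + 1) (by linarith)
  exact ⟨_, h1.le, h3⟩

theorem identI (hBVσ : L.σ2 = 0)
    (hBVPi : ∫⁻ y in Set.Ioo (-1 : ℝ) 0, ENNReal.ofReal (-y) ∂ L.levyMeasure ≠ ⊤)
    (a b q : ℝ) (hb : 0 ≤ b) (hq : 0 ≤ q) :
    volume.withDensity (kc (L.w q) (L.mu a b q)) =
      volume.withDensity (fun x => L.w q (-x)) + L.R a b q := by
  obtain ⟨l₀, h0, h⟩ := L.exists_large hBVσ hBVPi q
  have := L.mu_finite a b q hq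
  have hd : (fun x => L.w q (-x)) = kc (L.w q) (Measure.dirac 0) := by
    funext x; unfold kc
    have hm : Measurable (fun z => L.w q (z - x)) := (L.w_meas q hq).comp (measurable_id.sub_const x)
    rw [lintegral_dirac' _ hm, zero_sub]
  rw [hd]
  have hpos : ∀ l, l₀ < l → ENNReal.ofReal (1 / (L.ψ l - q)) ≠ ⊤ := fun _ _ => ENNReal.ofReal_ne_top
  have hL : ∀ l, l₀ < l → ∫⁻ x, ENNReal.ofReal (Real.exp (l * x))
      ∂ (volume.withDensity (kc (L.w q) (L.mu a b q))) =
      ENNReal.ofReal (1 / (L.ψ l - q)) + ∫⁻ z, ENNReal.ofReal (Real.exp (l * z)) ∂ L.R a b q := by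
    intro l hl
    obtain ⟨h1, h2, h3⟩ := h l hl
    rw [kc_hat (L.w_meas q hq), L.w_hat q hq l h2 h3, L.hat_eq a b l q hb h1.le hq h3, add_mul,
      one_mul, mul_right_comm, ← ENNReal.ofReal_mul (by linarith), mul_one_div_cancel (by linarith),
      ENNReal.ofReal_one, one_mul]
  refine laplace_unique _ _ l₀ ?_ ?_
  · intro l hl
    obtain ⟨h1, h2, h3⟩ := h l hl
    rw [hL l hl, lintegral_add_measure, kc_hat (L.w_meas q hq), L.w_hat q hq l h2 h3,
      lintegral_dirac' _ (by fun_prop)]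
    simp
  · intro l hl
    obtain ⟨h1, h2, h3⟩ := h l hl
    rw [hL l hl]
    exact ENNReal.add_ne_top.2 ⟨ENNReal.ofReal_ne_top, L.R_hat_fin a b l q hb h1.le hq h3⟩

/-- on the right of the lower level the convolution only sees the upper atom -/
theorem kc_right (hBVσ : L.σ2 = 0)
    (hBVPi : ∫⁻ y in Set.Ioo (-1 : ℝ) 0, ENNReal.ofReal (-y) ∂ L.levyMeasure ≠ ⊤)
    (a b q : ℝ) (ha : 0 ≤ a) (hb : 0 < b) (hq : 0 ≤ q) (x : ℝ) (hx : -a < x) :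
    kc (L.w q) (L.mu a b q) x = L.mu a b q {b} * L.w q (b - x) := by
  obtain ⟨l, h0, h1⟩ := L.exists_pos hBVσ hBVPi
  unfold kc
  have : ∀ᵐ z ∂ L.mu a b q, L.w q (z - x) = ({b} : Set ℝ).indicator (fun _ => L.w q (b - x)) z := by
    filter_upwards [L.mu_supp a b l q hb.le h0 h1] with z hz
    rcases hz with h | rfl
    · rw [Set.indicator_of_notMem (by simp only [Set.mem_singleton_iff]; intro h'; linarith),
        L.w_neg q hq _ (by linarith)]
    · rw [Set.indicator_of_mem (by simp)]
  rw [lintegral_congr_ae this, lintegral_indicator_const (measurableSet_singleton b), mul_comm]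

theorem m_ge (hBVσ : L.σ2 = 0)
    (hBVPi : ∫⁻ y in Set.Ioo (-1 : ℝ) 0, ENNReal.ofReal (-y) ∂ L.levyMeasure ≠ ⊤)
    (a b q : ℝ) (ha : 0 < a) (hb : 0 < b) (hq : 0 ≤ q) :
    L.w q a ≤ L.mu a b q {b} * L.w q (b + a) := by
  have := L.mu_finite a b q hq
  have hI := L.identI hBVσ hBVPi a b q hb.le hq
  have hle : ∀ᵐ x ∂ (volume : Measure ℝ), L.w q (-x) ≤ kc (L.w q) (L.mu a b q) x := by
    refine ae_le_of_forall_setLIntegral_le_of_sigmaFinite ((L.w_meas q hq).comp measurable_neg) ?_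
    intro s hs _
    rw [← withDensity_apply _ hs, ← withDensity_apply _ hs, hI, Measure.add_apply]
    exact le_self_add
  have hf : ∃ᶠ x in nhdsWithin (-a) (Set.Ioi (-a)), L.w q (-x) ≤ L.mu a b q {b} * L.w q (b - x) := by
    refine freq_ae_right (v := 0) (by linarith) ?_
    filter_upwards [hle] with x hx hx'
    rwa [L.kc_right hBVσ hBVPi a b q ha.le hb hq x hx'.1] at hx
  have hcont : ∀ c y : ℝ, 0 < c - y → Tendsto (fun x => L.w q (c - x)) (nhdsWithin y (Set.Ioi y))
      (nhds (L.w q (c - y))) := by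
    intro c y hy
    have h1 : ContinuousAt (L.W q) (c - y) := (L.Wcont q hq).continuousAt (Ioi_mem_nhds hy)
    have h2 : Tendsto (fun x : ℝ => c - x) (nhdsWithin y (Set.Ioi y)) (nhds (c - y)) :=
      ((continuous_const.sub continuous_id).tendsto y).mono_left nhdsWithin_le_nhds
    exact (ENNReal.continuous_ofReal.tendsto _).comp (h1.tendsto.comp h2)
  have h1 := hcont 0 (-a) (by linarith)
  have h2 := ENNReal.Tendsto.const_mul (a := L.mu a b q {b}) (hcont b (-a) (by linarith))
    (Or.inr (measure_ne_top _ _))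
  simp only [zero_sub, neg_neg, sub_neg_eq_add, zero_add] at h1 h2
  by_contra hcon
  push Not at hcon
  exact hf (by
    filter_upwards [(h2.eventually_lt h1 hcon)] with x hx
    exact not_le.2 hx)

theorem m_eq (hBVσ : L.σ2 = 0)
    (hBVPi : ∫⁻ y in Set.Ioo (-1 : ℝ) 0, ENNReal.ofReal (-y) ∂ L.levyMeasure ≠ ⊤)
    (a b q : ℝ) (ha : 0 ≤ a) (hb : 0 < b) :
    L.mu a b q {b} = ∫⁻ ω, ENNReal.ofReal (Real.exp (-q * L.T a b ω)) *
      ENNReal.ofReal (max (L.V a b ω) 0 / b) ∂ L.P 0 := by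
  obtain ⟨l, h0, h1⟩ := L.exists_pos hBVσ hBVPi
  rw [← L.mu_lintegral a b q (fun z => ENNReal.ofReal (max z 0 / b)) (by fun_prop),
    ← lintegral_indicator_one (measurableSet_singleton b)]
  refine lintegral_congr_ae ?_
  filter_upwards [L.mu_supp a b l q hb.le h0 h1] with z hz
  rcases hz with h | rfl
  · rw [Set.indicator_of_notMem (by simp only [Set.mem_singleton_iff]; intro h'; linarith),
      max_eq_right (by linarith)]; simp
  · rw [Set.indicator_of_mem (by simp), max_eq_left hb.le, div_self hb.ne']; simp

theorem m_lim (hBVσ : L.σ2 = 0)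
    (hBVPi : ∫⁻ y in Set.Ioo (-1 : ℝ) 0, ENNReal.ofReal (-y) ∂ L.levyMeasure ≠ ⊤)
    (b q : ℝ) (hb : 0 < b) (hq : 0 ≤ q) :
    Tendsto (fun n : ℕ => L.mu (1 / ((n : ℝ) + 1)) b q {b}) atTop (nhds (L.mu 0 b q {b})) := by
  have := L.probP 0
  obtain ⟨l, h0, h1⟩ := L.exists_pos hBVσ hBVPi
  have hpos : ∀ n : ℕ, 0 < 1 / ((n : ℝ) + 1) := fun n => by positivity
  rw [L.m_eq hBVσ hBVPi 0 b q le_rfl hb]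
  simp only [fun n => L.m_eq hBVσ hBVPi _ b q (hpos n).le hb]
  have hT := fun a => L.T_meas a b
  have hV := fun a => L.V_meas a b
  refine tendsto_lintegral_of_dominated_convergence (fun _ => 1) ?_ ?_ (by simp) ?_
  · intro n
    have h1 := hT (1 / ((n : ℝ) + 1))
    have h2 := hV (1 / ((n : ℝ) + 1))
    fun_prop
  · intro n
    filter_upwards [L.good, L.EX_ae (1 / ((n : ℝ) + 1)) b l hb.le h0 h1] with ω hg hE
    have hVe : L.V (1 / ((n : ℝ) + 1)) b ω = L.X (L.T _ b ω) ω := hg.XR_eq _ (L.T_nonneg _ b ω)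
    have hVb : L.V (1 / ((n : ℝ) + 1)) b ω ≤ b := by rw [hVe]; exact hg.TP_le hb.le hE
    refine mul_le_one' ?_ ?_
    · rw [ENNReal.ofReal_le_one, Real.exp_le_one_iff]
      have := mul_nonneg hq (L.T_nonneg (1 / ((n : ℝ) + 1)) b ω)
      linarith
    · rw [ENNReal.ofReal_le_one, div_le_one hb]
      exact max_le hVb hb.le
  · have hE : ∀ᵐ ω ∂ L.P 0, ∀ n : ℕ, EX (fun u => L.X u ω) (1 / ((n : ℝ) + 1)) b :=
      ae_all_iff.2 fun n => L.EX_ae _ b l hb.le h0 h1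
    filter_upwards [L.good, hE, L.EX_ae 0 b l hb.le h0 h1] with ω hg hE hE0
    obtain ⟨k1, k2⟩ := hg.TP_tendsto (fun n : ℕ => 1 / ((n : ℝ) + 1)) hpos
      tendsto_one_div_add_atTop_nhds_zero_nat hE hE0
    have hVe : ∀ a, L.V a b ω = L.X (L.T a b ω) ω := fun a => hg.XR_eq _ (L.T_nonneg _ b ω)
    simp only [hVe]
    refine ENNReal.Tendsto.mul ?_ (Or.inr ENNReal.ofReal_ne_top) ?_ (Or.inr ENNReal.ofReal_ne_top)
    · exact ENNReal.tendsto_ofReal ((Real.continuous_exp.tendsto _).comp (k2.const_mul (-q)))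
    · exact ENNReal.tendsto_ofReal ((k1.max tendsto_const_nhds).div_const b)

end SNLevy


namespace SNLevy

variable {Ω : Type} [MeasurableSpace Ω] (L : SNLevy Ω)

theorem R_supp0 (hBVσ : L.σ2 = 0)
    (hBVPi : ∫⁻ y in Set.Ioo (-1 : ℝ) 0, ENNReal.ofReal (-y) ∂ L.levyMeasure ≠ ⊤)
    (b q : ℝ) (hb : 0 < b) (hq : 0 ≤ q) : L.R 0 b q (Set.Iio 0) = 0 := by
  obtain ⟨l, h0, h1⟩ := L.exists_pos hBVσ hBVPi
  rw [measure_eq_zero_iff_ae_notMem]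
  filter_upwards [L.R_supp 0 b l q hb.le h0 h1] with z hz hz'
  have : z < 0 := hz'
  linarith [hz.1]

theorem kc_left (hBVσ : L.σ2 = 0)
    (hBVPi : ∫⁻ y in Set.Ioo (-1 : ℝ) 0, ENNReal.ofReal (-y) ∂ L.levyMeasure ≠ ⊤)
    (b q : ℝ) (hb : 0 < b) (hq : 0 ≤ q) :
    ∀ᵐ x : ℝ, x < 0 → kc (L.w q) (L.mu 0 b q) x = L.w q (-x) := by
  have := L.mu_finite 0 b q hq
  have hI := L.identI hBVσ hBVPi 0 b q hb.le hq
  have hR := L.R_supp0 hBVσ hBVPi b q hb hq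
  have h1 : kc (L.w q) (L.mu 0 b q) =ᵐ[volume.restrict (Set.Iio 0)] fun x => L.w q (-x) := by
    refine ae_eq_of_forall_setLIntegral_eq_of_sigmaFinite (kc_meas (L.w_meas q hq) _)
      ((L.w_meas q hq).comp measurable_neg) ?_
    intro s hs _
    rw [Measure.restrict_restrict hs]
    have hs' : MeasurableSet (s ∩ Set.Iio (0 : ℝ)) := hs.inter measurableSet_Iio
    rw [← withDensity_apply _ hs', ← withDensity_apply _ hs', hI, Measure.add_apply,
      measure_mono_null Set.inter_subset_right hR, add_zero]
  exact (ae_restrict_iff' measurableSet_Iio).1 h1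

theorem w_right (q : ℝ) (hq : 0 ≤ q) (c : ℝ) (hc : 0 ≤ c) :
    Tendsto (fun x => L.w q (c - x)) (nhdsWithin 0 (Set.Iio 0)) (nhds (L.w q c)) := by
  have h1 := (L.W_contOn q hq) c hc
  have h2 : Tendsto (fun x : ℝ => c - x) (nhdsWithin 0 (Set.Iio 0)) (nhdsWithin c (Set.Ici 0)) := by
    rw [tendsto_nhdsWithin_iff]
    constructor
    · have hc : Continuous (fun x : ℝ => c - x) := by fun_prop
      have := hc.tendsto 0
      rw [sub_zero] at this
      exact this.mono_left nhdsWithin_le_nhds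
    · filter_upwards [self_mem_nhdsWithin] with x hx
      have : x < 0 := hx
      show 0 ≤ c - x
      linarith
  exact (ENNReal.continuous_ofReal.tendsto _).comp (h1.tendsto.comp h2)

theorem m_zero_eq (hBVσ : L.σ2 = 0)
    (hBVPi : ∫⁻ y in Set.Ioo (-1 : ℝ) 0, ENNReal.ofReal (-y) ∂ L.levyMeasure ≠ ⊤)
    (b q : ℝ) (hb : 0 < b) (hq : 0 ≤ q) :
    L.mu 0 b q {0} * L.w q 0 + L.mu 0 b q {b} * L.w q b = L.w q 0 := by
  have := L.mu_finite 0 b q hq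
  obtain ⟨l, h0, h1⟩ := L.exists_pos hBVσ hBVPi
  have hk := L.kc_left hBVσ hBVPi b q hb hq
  have hf : ∃ᶠ x in nhdsWithin 0 (Set.Iio 0), kc (L.w q) (L.mu 0 b q) x = L.w q (0 - x) := by
    refine freq_ae_left (u := -1) (by norm_num) ?_
    filter_upwards [hk] with x hx hx'
    rw [hx hx'.2, zero_sub]
  obtain ⟨C, hC0, hC⟩ := L.W_bdd q hq (b + 1)
  have hlim : Tendsto (kc (L.w q) (L.mu 0 b q)) (nhdsWithin 0 (Set.Iio 0))
      (nhds (∫⁻ z, (({0} : Set ℝ).indicator (fun _ => L.w q 0) z +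
        ({b} : Set ℝ).indicator (fun _ => L.w q b) z) ∂ L.mu 0 b q)) := by
    refine tendsto_lintegral_filter_of_dominated_convergence (fun _ => ENNReal.ofReal C) ?_ ?_ ?_ ?_
    · exact Eventually.of_forall fun x => (L.w_meas q hq).comp (measurable_id.sub_const x)
    · filter_upwards [Ioo_mem_nhdsLT (show (-1 : ℝ) < 0 by norm_num)] with x hx
      filter_upwards [L.mu_supp 0 b l q hb.le h0 h1] with z hz
      refine ENNReal.ofReal_le_ofReal (hC _ ?_)
      have := hx.1
      rcases hz with h | h <;> linarith
    · rw [lintegral_const]; exact ENNReal.mul_ne_top ENNReal.ofReal_ne_top (measure_ne_top _ _)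
    · filter_upwards [L.mu_supp 0 b l q hb.le h0 h1] with z hz
      rcases hz with h | rfl
      · rcases (neg_zero (G := ℝ) ▸ h : z ≤ 0).eq_or_lt with rfl | h
        · rw [Set.indicator_of_mem (by simp), Set.indicator_of_notMem (by simpa using hb.ne), add_zero]
          exact L.w_right q hq 0 le_rfl
        · rw [Set.indicator_of_notMem (by simpa using h.ne),
            Set.indicator_of_notMem (by simpa using (h.trans hb).ne), add_zero]
          refine tendsto_const_nhds.congr' ?_
          filter_upwards [Ioo_mem_nhdsLT h] with x hx
          rw [L.w_neg q hq _ (by linarith [hx.1])]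
      · rw [Set.indicator_of_notMem (by simpa using hb.ne'), Set.indicator_of_mem (by simp), zero_add]
        exact L.w_right q hq z hb.le
  have := tendsto_nhds_unique_of_frequently_eq hlim (L.w_right q hq 0 le_rfl) hf
  rw [lintegral_add_left (by fun_prop (disch := measurability)),
    lintegral_indicator_const (measurableSet_singleton _),
    lintegral_indicator_const (measurableSet_singleton _)] at this
  rw [mul_comm, mul_comm (L.mu 0 b q {b})]; exact this

theorem m_zero_ge (hBVσ : L.σ2 = 0)
    (hBVPi : ∫⁻ y in Set.Ioo (-1 : ℝ) 0, ENNReal.ofReal (-y) ∂ L.levyMeasure ≠ ⊤)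
    (b q : ℝ) (hb : 0 < b) (hq : 0 ≤ q) :
    L.w q 0 ≤ L.mu 0 b q {b} * L.w q b := by
  have := L.mu_finite 0 b q hq
  have hpos : ∀ n : ℕ, 0 < 1 / ((n : ℝ) + 1) := fun n => by positivity
  have hseq : Tendsto (fun n : ℕ => -(1 / ((n : ℝ) + 1))) atTop (nhdsWithin 0 (Set.Iio 0)) := by
    rw [tendsto_nhdsWithin_iff]
    refine ⟨by simpa using (tendsto_one_div_add_atTop_nhds_zero_nat (𝕜 := ℝ)).neg, ?_⟩
    exact Eventually.of_forall fun n => by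
      show -(1 / ((n : ℝ) + 1)) < 0
      linarith [hpos n]
  have h1 := (L.w_right q hq 0 le_rfl).comp hseq
  have h2 := ENNReal.Tendsto.mul (L.m_lim hBVσ hBVPi b q hb hq) (Or.inr ENNReal.ofReal_ne_top)
    ((L.w_right q hq b hb.le).comp hseq) (Or.inr (measure_ne_top _ _))
  refine le_of_tendsto_of_tendsto' h1 h2 fun n => ?_
  have := L.m_ge hBVσ hBVPi _ b q (hpos n) hb hq
  simpa using this

theorem w0_pos (hBVσ : L.σ2 = 0)
    (hBVPi : ∫⁻ y in Set.Ioo (-1 : ℝ) 0, ENNReal.ofReal (-y) ∂ L.levyMeasure ≠ ⊤)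
    (q : ℝ) (hq : 0 ≤ q) : 0 < L.w q 0 :=
  ENNReal.ofReal_pos.2 (L.W0_pos hBVσ hBVPi q hq)

theorem m_b (hBVσ : L.σ2 = 0)
    (hBVPi : ∫⁻ y in Set.Ioo (-1 : ℝ) 0, ENNReal.ofReal (-y) ∂ L.levyMeasure ≠ ⊤)
    (b q : ℝ) (hb : 0 < b) (hq : 0 ≤ q) :
    L.mu 0 b q {b} * L.w q b = L.w q 0 :=
  le_antisymm ((le_add_self).trans (L.m_zero_eq hBVσ hBVPi b q hb hq).le)
    (L.m_zero_ge hBVσ hBVPi b q hb hq)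

theorem m_0 (hBVσ : L.σ2 = 0)
    (hBVPi : ∫⁻ y in Set.Ioo (-1 : ℝ) 0, ENNReal.ofReal (-y) ∂ L.levyMeasure ≠ ⊤)
    (b q : ℝ) (hb : 0 < b) (hq : 0 ≤ q) :
    L.mu 0 b q {0} = 0 := by
  have h := L.m_zero_eq hBVσ hBVPi b q hb hq
  rw [L.m_b hBVσ hBVPi b q hb hq] at h
  have h2 : L.mu 0 b q {0} * L.w q 0 = 0 := by
    have : L.mu 0 b q {0} * L.w q 0 + L.w q 0 = 0 + L.w q 0 := by rw [h, zero_add]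
    exact (ENNReal.add_left_inj (show L.w q 0 ≠ ⊤ from ENNReal.ofReal_ne_top)).1 this
  exact (mul_eq_zero.1 h2).resolve_right (L.w0_pos hBVσ hBVPi q hq).ne'

theorem R_eq (hBVσ : L.σ2 = 0)
    (hBVPi : ∫⁻ y in Set.Ioo (-1 : ℝ) 0, ENNReal.ofReal (-y) ∂ L.levyMeasure ≠ ⊤)
    (b q : ℝ) (hb : 0 < b) (hq : 0 ≤ q) :
    L.R 0 b q = (volume.restrict (Set.Ioi 0)).withDensity
      (fun x => L.mu 0 b q {b} * L.w q (b - x)) := by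
  have := L.mu_finite 0 b q hq
  have hI := L.identI hBVσ hBVPi 0 b q hb.le hq
  have hR := L.R_supp0 hBVσ hBVPi b q hb hq
  have hle : L.R 0 b q ≤ volume.withDensity (kc (L.w q) (L.mu 0 b q)) := by
    rw [hI]; exact Measure.le_add_left le_rfl
  have hz : L.R 0 b q (Set.Iic 0) = 0 := by
    rw [← Set.Iio_union_right, measure_union_null_iff]
    refine ⟨hR, ?_⟩
    refine le_antisymm ((hle _).trans ?_) zero_le
    exact (withDensity_absolutelyContinuous _ _ (measure_singleton _)).le
  ext s hs
  have hs' : MeasurableSet (s ∩ Set.Ioi (0 : ℝ)) := hs.inter measurableSet_Ioi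
  have e1 : L.R 0 b q s = L.R 0 b q (s ∩ Set.Ioi 0) := by
    rw [← measure_inter_add_sdiff s (measurableSet_Ioi (a := (0 : ℝ)))]
    have hd : L.R 0 b q (s \ Set.Ioi 0) = 0 := by
      refine measure_mono_null ?_ hz
      rintro x ⟨_, hx⟩
      simpa using hx
    rw [hd, add_zero]
  have e2 : L.R 0 b q (s ∩ Set.Ioi 0) = volume.withDensity (kc (L.w q) (L.mu 0 b q)) (s ∩ Set.Ioi 0) := by
    rw [hI, Measure.add_apply, withDensity_apply _ hs']
    rw [setLIntegral_congr_fun (g := fun _ => 0) hs', lintegral_zero, zero_add]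
    rintro x ⟨_, hx⟩
    have : 0 < x := hx
    exact L.w_neg q hq _ (by linarith)
  rw [e1, e2, withDensity_apply _ hs', withDensity_apply _ hs, Measure.restrict_restrict hs]
  refine setLIntegral_congr_fun hs' ?_
  rintro x ⟨_, hx⟩
  exact L.kc_right hBVσ hBVPi 0 b q le_rfl hb hq x (by rw [neg_zero]; exact hx)

end SNLevy


/-- Heaviside kernel -/
def k1 (y : ℝ) : ℝ≥0∞ := (Set.Ioi (0 : ℝ)).indicator (fun _ => 1) y

theorem k1_meas : Measurable k1 := measurable_const.indicator measurableSet_Ioi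

theorem exp_lint (l : ℝ) (hl : 0 < l) (c : ℝ) (hc : 0 ≤ c) :
    ∫⁻ y in Set.Ioo (0 : ℝ) c, ENNReal.ofReal (Real.exp (-l * y)) =
      ENNReal.ofReal ((1 - Real.exp (-l * c)) / l) := by
  have hcont : Continuous (fun y : ℝ => Real.exp (-l * y)) := by fun_prop
  rw [← ofReal_integral_eq_lintegral_ofReal
    ((hcont.integrableOn_Icc (a := 0) (b := c)).mono_set Set.Ioo_subset_Icc_self)
    (ae_of_all _ fun y => (Real.exp_pos _).le)]
  congr 1
  rw [← integral_Ioc_eq_integral_Ioo, ← intervalIntegral.integral_of_le hc]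
  rw [intervalIntegral.integral_comp_mul_left (fun y => Real.exp y) (neg_ne_zero.2 hl.ne')]
  rw [integral_exp]
  simp
  field_simp
  ring

theorem k1_hat (l : ℝ) (hl : 0 < l) :
    ∫⁻ y, k1 y * ENNReal.ofReal (Real.exp (-l * y)) = ENNReal.ofReal (1 / l) := by
  have h1 : ∀ y, k1 y * ENNReal.ofReal (Real.exp (-l * y)) =
      (Set.Ioi (0 : ℝ)).indicator (fun y => ENNReal.ofReal (Real.exp (-l * y))) y := by
    intro y
    unfold k1
    by_cases hy : y ∈ Set.Ioi (0 : ℝ)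
    · rw [Set.indicator_of_mem hy, Set.indicator_of_mem hy, one_mul]
    · rw [Set.indicator_of_notMem hy, Set.indicator_of_notMem hy, zero_mul]
  simp only [h1]
  rw [lintegral_indicator measurableSet_Ioi, ← ofReal_integral_eq_lintegral_ofReal
    (integrableOn_exp_mul_Ioi (by linarith) 0) (ae_of_all _ fun y => (Real.exp_pos _).le),
    integral_exp_mul_Ioi (by linarith)]
  congr 1
  simp

namespace SNLevy

variable {Ω : Type} [MeasurableSpace Ω] (L : SNLevy Ω)

theorem Pi_sfinite
    (hBVPi : ∫⁻ y in Set.Ioo (-1 : ℝ) 0, ENNReal.ofReal (-y) ∂ L.levyMeasure ≠ ⊤) :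
    SFinite L.levyMeasure := by
  have hi := L.min_int hBVPi
  set f : ℝ → ℝ≥0∞ := fun y => ENNReal.ofReal (min 1 |y|) with hf
  have hfm : Measurable f := by fun_prop
  have hfin : IsFiniteMeasure (L.levyMeasure.withDensity f) :=
    isFiniteMeasure_withDensity_ofReal hi.2
  have h := withDensity_inv_same (μ := L.levyMeasure) hfm (by
    filter_upwards [L.ae_neg] with y hy
    have : 0 < |y| := abs_pos.2 hy.ne
    exact (ENNReal.ofReal_pos.2 (lt_min one_pos this)).ne') (ae_of_all _ fun y => ENNReal.ofReal_ne_top)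
  rw [← h]
  infer_instance

/-- tail kernel -/
def k2 (y : ℝ) : ℝ≥0∞ := (Set.Ioi (0 : ℝ)).indicator (fun y => L.levyMeasure (Set.Iio (-y))) y

theorem k2_meas : Measurable L.k2 := by
  refine Measurable.indicator ?_ measurableSet_Ioi
  have : Antitone (fun y : ℝ => L.levyMeasure (Set.Iio (-y))) := fun x y h =>
    measure_mono (Set.Iio_subset_Iio (by linarith))
  exact this.measurable

theorem k2_hat
    (hBVPi : ∫⁻ y in Set.Ioo (-1 : ℝ) 0, ENNReal.ofReal (-y) ∂ L.levyMeasure ≠ ⊤)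
    (l : ℝ) (hl : 0 < l) :
    ∫⁻ y, L.k2 y * ENNReal.ofReal (Real.exp (-l * y)) =
      ENNReal.ofReal ((∫ y, (1 - Real.exp (l * y)) ∂ L.levyMeasure) / l) := by
  have := L.Pi_sfinite hBVPi
  have he : Measurable (fun x : ℝ => ENNReal.ofReal (Real.exp (-l * x))) := by fun_prop
  set S : Set (ℝ × ℝ) := {p | 0 < p.1 ∧ p.2 < -p.1} with hS
  have hSm : MeasurableSet S := by
    exact (measurableSet_lt measurable_const measurable_fst).inter
      (measurableSet_lt measurable_snd measurable_fst.neg)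
  have h1 : ∀ y, L.k2 y * ENNReal.ofReal (Real.exp (-l * y)) =
      ∫⁻ u, S.indicator (fun p => ENNReal.ofReal (Real.exp (-l * p.1))) (y, u) ∂ L.levyMeasure := by
    intro y
    unfold k2
    by_cases hy : 0 < y
    · rw [Set.indicator_of_mem (by exact hy)]
      have : ∀ u, S.indicator (fun p => ENNReal.ofReal (Real.exp (-l * p.1))) (y, u) =
          (Set.Iio (-y)).indicator (fun _ => ENNReal.ofReal (Real.exp (-l * y))) u := by
        intro u
        by_cases hu : u < -y
        · rw [Set.indicator_of_mem (show (y, u) ∈ S from ⟨hy, hu⟩), Set.indicator_of_mem (by exact hu)]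
        · rw [Set.indicator_of_notMem (fun h : (y, u) ∈ S => hu h.2), Set.indicator_of_notMem (by exact hu)]
      simp only [this]
      rw [lintegral_indicator_const measurableSet_Iio, mul_comm]
    · rw [Set.indicator_of_notMem (by exact hy), zero_mul]
      have : ∀ u, S.indicator (fun p => ENNReal.ofReal (Real.exp (-l * p.1))) (y, u) = 0 := fun u =>
        Set.indicator_of_notMem (fun h : (y, u) ∈ S => hy h.1) _
      simp only [this, lintegral_zero]
  simp only [h1]
  rw [lintegral_lintegral_swap (by
    exact ((he.comp measurable_fst).indicator hSm).aemeasurable)]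
  have hnn : ∀ᵐ y ∂ L.levyMeasure, 0 ≤ (1 - Real.exp (l * y)) / l := by
    filter_upwards [L.ae_neg] with y hy
    exact div_nonneg (one_sub_exp_bd l y hl.le hy).1 hl.le
  rw [← integral_div, ofReal_integral_eq_lintegral_ofReal ((L.one_sub_exp_int hBVPi l hl.le).div_const l)
    hnn]
  refine lintegral_congr_ae ?_
  filter_upwards [L.ae_neg] with u hu
  have : ∀ y, S.indicator (fun p => ENNReal.ofReal (Real.exp (-l * p.1))) (y, u) =
      (Set.Ioo 0 (-u)).indicator (fun y => ENNReal.ofReal (Real.exp (-l * y))) y := by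
    intro y
    by_cases h : (y, u) ∈ S
    · rw [Set.indicator_of_mem h, Set.indicator_of_mem (show y ∈ Set.Ioo 0 (-u) from ⟨h.1, by linarith [h.2]⟩)]
    · rw [Set.indicator_of_notMem h, Set.indicator_of_notMem (fun h1 : y ∈ Set.Ioo 0 (-u) => h ⟨h1.1, by show u < -y; linarith [h1.2]⟩)]
  simp only [this]
  rw [lintegral_indicator measurableSet_Ioo, exp_lint l hl (-u) (by linarith)]
  congr 3
  ring_nf

theorem identII (hBVσ : L.σ2 = 0)
    (hBVPi : ∫⁻ y in Set.Ioo (-1 : ℝ) 0, ENNReal.ofReal (-y) ∂ L.levyMeasure ≠ ⊤)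
    (a b q : ℝ) (hb : 0 ≤ b) (hq : 0 ≤ q) :
    volume.withDensity (kc k1 (L.mu a b q)) +
      (ENNReal.ofReal q • volume.withDensity (kc k1 (L.R a b q)) +
        volume.withDensity (kc L.k2 (L.R a b q))) =
      volume.withDensity (kc k1 (Measure.dirac 0)) + ENNReal.ofReal L.drift • L.R a b q := by
  obtain ⟨l₀, h0, h⟩ := L.exists_large hBVσ hBVPi q
  have := L.mu_finite a b q hq
  have := L.R_fin hBVσ hBVPi a b q hb hq
  have hc := L.drift_pos hBVσ hBVPi
  have key : ∀ l, l₀ < l → ∫⁻ x, ENNReal.ofReal (Real.exp (l * x))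
      ∂ (volume.withDensity (kc k1 (L.mu a b q)) +
      (ENNReal.ofReal q • volume.withDensity (kc k1 (L.R a b q)) +
        volume.withDensity (kc L.k2 (L.R a b q)))) = ENNReal.ofReal (1 / l) + ENNReal.ofReal L.drift *
          ∫⁻ z, ENNReal.ofReal (Real.exp (l * z)) ∂ L.R a b q := by
    intro l hl
    obtain ⟨h1, h2, h3⟩ := h l hl
    rw [lintegral_add_measure, lintegral_add_measure, lintegral_smul_measure, kc_hat k1_meas,
      kc_hat k1_meas, kc_hat L.k2_meas, k1_hat l h1, L.k2_hat hBVPi l h1,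
      L.hat_eq a b l q hb h1.le hq h3]
    set K := ∫ y, (1 - Real.exp (l * y)) ∂ L.levyMeasure with hK
    have hK0 : 0 ≤ K := integral_nonneg_of_ae (by
      filter_upwards [L.ae_neg] with y hy
      exact (one_sub_exp_bd l y h1.le hy).1)
    have hpsi := L.psi_eq hBVσ hBVPi l h1.le
    set r := ∫⁻ z, ENNReal.ofReal (Real.exp (l * z)) ∂ L.R a b q
    have e : ENNReal.ofReal L.drift = ENNReal.ofReal (L.ψ l - q) * ENNReal.ofReal (1 / l) +
        (ENNReal.ofReal q * ENNReal.ofReal (1 / l) + ENNReal.ofReal (K / l)) := by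
      rw [← ENNReal.ofReal_mul (by linarith), ← ENNReal.ofReal_mul hq, ← ENNReal.ofReal_add
        (by positivity) (by positivity), ← ENNReal.ofReal_add (mul_nonneg (by linarith) (by positivity))
        (by positivity)]
      congr 1
      rw [hpsi]; field_simp; ring
    rw [e, smul_eq_mul]; ring
  refine laplace_unique _ _ l₀ ?_ ?_
  · intro l hl
    obtain ⟨h1, h2, h3⟩ := h l hl
    rw [key l hl, lintegral_add_measure, lintegral_smul_measure, kc_hat k1_meas, k1_hat l h1,
      lintegral_dirac' _ (by fun_prop)]
    simp
  · intro l hl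
    obtain ⟨h1, h2, h3⟩ := h l hl
    rw [key l hl]
    exact ENNReal.add_ne_top.2 ⟨ENNReal.ofReal_ne_top, ENNReal.mul_ne_top ENNReal.ofReal_ne_top
      (L.R_hat_fin a b l q hb h1.le hq h3)⟩

end SNLevy


namespace SNLevy

variable {Ω : Type} [MeasurableSpace Ω] (L : SNLevy Ω)

/-- occupation measure convolved with the jump measure -/
def nu (b q : ℝ) : Measure ℝ := ((L.R 0 b q).prod L.levyMeasure).map (fun p => p.1 + p.2)

theorem nu_lintegral
    (hBVPi : ∫⁻ y in Set.Ioo (-1 : ℝ) 0, ENNReal.ofReal (-y) ∂ L.levyMeasure ≠ ⊤)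
    (b q : ℝ) (f : ℝ → ℝ≥0∞) (hf : Measurable f) :
    ∫⁻ z, f z ∂ L.nu b q = ∫⁻ y, ∫⁻ u, f (y + u) ∂ L.levyMeasure ∂ L.R 0 b q := by
  have := L.Pi_sfinite hBVPi
  unfold nu
  have ha : Measurable (fun p : ℝ × ℝ => p.1 + p.2) := by fun_prop
  rw [lintegral_map hf ha]
  exact lintegral_prod _ (hf.comp ha).aemeasurable

theorem nu_Iio
    (hBVPi : ∫⁻ y in Set.Ioo (-1 : ℝ) 0, ENNReal.ofReal (-y) ∂ L.levyMeasure ≠ ⊤)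
    (b q x : ℝ) : L.nu b q (Set.Iio x) = ∫⁻ y, L.levyMeasure (Set.Iio (x - y)) ∂ L.R 0 b q := by
  rw [← lintegral_indicator_one measurableSet_Iio, L.nu_lintegral hBVPi b q _
    (measurable_one.indicator measurableSet_Iio)]
  refine lintegral_congr fun y => ?_
  rw [← lintegral_indicator_one measurableSet_Iio]
  refine lintegral_congr fun u => ?_
  simp only [Set.indicator, Set.mem_Iio, lt_sub_iff_add_lt', Pi.one_apply]

theorem balance_ae (hBVσ : L.σ2 = 0)
    (hBVPi : ∫⁻ y in Set.Ioo (-1 : ℝ) 0, ENNReal.ofReal (-y) ∂ L.levyMeasure ≠ ⊤)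
    (b q : ℝ) (hb : 0 < b) (hq : 0 ≤ q) :
    ∀ᵐ x : ℝ, x < 0 → L.mu 0 b q (Set.Ioi x) +
      (ENNReal.ofReal q * L.R 0 b q Set.univ + L.nu b q (Set.Iio x)) = 1 := by
  have := L.mu_finite 0 b q hq
  have := L.R_fin hBVσ hBVPi 0 b q hb.le hq
  have hI := L.identII hBVσ hBVPi 0 b q hb.le hq
  have hR := L.R_supp0 hBVσ hBVPi b q hb hq
  have m1 := kc_meas k1_meas (L.mu 0 b q)
  have m2 := kc_meas k1_meas (L.R 0 b q)
  have m3 := kc_meas L.k2_meas (L.R 0 b q)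
  have m4 := kc_meas k1_meas (Measure.dirac (0 : ℝ))
  have h1 : (fun x => kc k1 (L.mu 0 b q) x + (ENNReal.ofReal q * kc k1 (L.R 0 b q) x +
      kc L.k2 (L.R 0 b q) x)) =ᵐ[volume.restrict (Set.Iio 0)] kc k1 (Measure.dirac 0) := by
    refine ae_eq_of_forall_setLIntegral_eq_of_sigmaFinite (by fun_prop) m4 ?_
    intro s hs _
    rw [Measure.restrict_restrict hs]
    have hs' : MeasurableSet (s ∩ Set.Iio (0 : ℝ)) := hs.inter measurableSet_Iio
    have := congrArg (fun m : Measure ℝ => m (s ∩ Set.Iio 0)) hI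
    simp only [Measure.add_apply, Measure.smul_apply, withDensity_apply _ hs',
      measure_mono_null Set.inter_subset_right hR, smul_eq_mul] at this
    rw [mul_zero, add_zero] at this
    rw [lintegral_add_left m1, lintegral_add_left (m2.const_mul _), lintegral_const_mul _ m2]
    exact this
  have h2 := (ae_restrict_iff' measurableSet_Iio).1 h1
  have hRae : ∀ᵐ z ∂ L.R 0 b q, 0 ≤ z := by
    filter_upwards [measure_eq_zero_iff_ae_notMem.1 hR] with z hz
    exact not_lt.1 hz
  filter_upwards [h2] with x hx hx0
  have e := hx hx0
  have e1 : kc k1 (L.mu 0 b q) x = L.mu 0 b q (Set.Ioi x) := by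
    unfold kc
    rw [← lintegral_indicator_one measurableSet_Ioi]
    refine lintegral_congr fun u => ?_
    simp only [k1, Set.indicator, Set.mem_Ioi, sub_pos, Pi.one_apply]
  have e2 : kc k1 (L.R 0 b q) x = L.R 0 b q Set.univ := by
    unfold kc
    rw [← lintegral_one]
    refine lintegral_congr_ae ?_
    filter_upwards [hRae] with z hz
    exact Set.indicator_of_mem (by show 0 < z - x; linarith) _
  have e3 : kc L.k2 (L.R 0 b q) x = L.nu b q (Set.Iio x) := by
    rw [L.nu_Iio hBVPi]
    unfold kc
    refine lintegral_congr_ae ?_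
    filter_upwards [hRae] with z hz
    unfold k2
    rw [Set.indicator_of_mem (by show 0 < z - x; linarith), neg_sub]
  have e4 : kc k1 (Measure.dirac 0) x = 1 := by
    unfold kc
    have hm : Measurable (fun z => k1 (z - x)) := k1_meas.comp (measurable_id.sub_const x)
    rw [lintegral_dirac' _ hm]
    exact Set.indicator_of_mem (by show 0 < 0 - x; linarith) _
  rw [← e4, ← e1, ← e2, ← e3]
  exact e

theorem mass (hBVσ : L.σ2 = 0)
    (hBVPi : ∫⁻ y in Set.Ioo (-1 : ℝ) 0, ENNReal.ofReal (-y) ∂ L.levyMeasure ≠ ⊤)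
    (b q : ℝ) (hb : 0 < b) (hq : 0 ≤ q) :
    L.mu 0 b q Set.univ + ENNReal.ofReal q * L.R 0 b q Set.univ = 1 := by
  have := L.mu_finite 0 b q hq
  have hB := L.balance_ae hBVσ hBVPi b q hb hq
  have hD := Measure.dense_of_ae hB
  have hf : ∃ᶠ x in atBot, L.mu 0 b q (Set.Ioi x) +
      (ENNReal.ofReal q * L.R 0 b q Set.univ + L.nu b q (Set.Iio x)) = 1 := by
    rw [frequently_atBot]
    intro c
    obtain ⟨d, hd1, hd2⟩ := hD.exists_between (show min c 0 - 1 < min c 0 by linarith)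
    exact ⟨d, (hd2.2.trans_le (min_le_left _ _)).le, hd1 (hd2.2.trans_le (min_le_right _ _))⟩
  have t1 : Tendsto (fun x => L.mu 0 b q (Set.Ioi x)) atBot (nhds (L.mu 0 b q Set.univ)) := by
    refine tendsto_of_tendsto_of_tendsto_of_le_of_le
      ((tendsto_measure_Ici_atBot (L.mu 0 b q)).comp (tendsto_atBot_add_const_right atBot (1 : ℝ) tendsto_id))
      tendsto_const_nhds ?_ ?_
    · intro x
      refine measure_mono fun z hz => ?_
      have h1 : x + 1 ≤ z := hz
      show x < z
      linarith
    · exact fun x => measure_mono (Set.subset_univ _)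
  have t2 : Tendsto (fun x => L.nu b q (Set.Iio x)) atBot (nhds 0) := by
    obtain ⟨d, hd⟩ := hf.exists
    have hfin : L.nu b q (Set.Iio d) ≠ ⊤ := by
      intro h
      rw [h] at hd
      simp at hd
    have := tendsto_measure_iInter_atBot (μ := L.nu b q) (s := fun x : ℝ => Set.Iio x)
      (fun x => measurableSet_Iio.nullMeasurableSet) (fun x y h => Set.Iio_subset_Iio h) ⟨d, hfin⟩
    have he : (⋂ x : ℝ, Set.Iio x) = ∅ := by
      ext z
      simp only [Set.mem_iInter, Set.mem_Iio, Set.mem_empty_iff_false, iff_false]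
      exact fun h => lt_irrefl _ (h z)
    rwa [he, measure_empty] at this
  have := tendsto_nhds_unique_of_frequently_eq (t1.add (tendsto_const_nhds.add t2)) tendsto_const_nhds hf
  rwa [add_zero] at this

theorem mu_Iio (hBVσ : L.σ2 = 0)
    (hBVPi : ∫⁻ y in Set.Ioo (-1 : ℝ) 0, ENNReal.ofReal (-y) ∂ L.levyMeasure ≠ ⊤)
    (b q : ℝ) (hb : 0 < b) (hq : 0 ≤ q) (x : ℝ) (hx : x ≤ 0) :
    L.mu 0 b q (Set.Iio x) = L.nu b q (Set.Iio x) := by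
  have := L.mu_finite 0 b q hq
  have := L.R_fin hBVσ hBVPi 0 b q hb.le hq
  have hB := L.balance_ae hBVσ hBVPi b q hb hq
  have hM := L.mass hBVσ hBVPi b q hb hq
  have hB2 : ∀ᵐ x : ℝ, x < 0 → L.mu 0 b q (Set.Iic x) = L.nu b q (Set.Iio x) := by
    filter_upwards [hB] with x h hx
    have h := h hx
    have hs : L.mu 0 b q Set.univ = L.mu 0 b q (Set.Iic x) + L.mu 0 b q (Set.Ioi x) := by
      rw [← Set.Iic_union_Ioi (a := x), measure_union (Set.Iic_disjoint_Ioi le_rfl) measurableSet_Ioi]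
    rw [← hM, hs] at h
    have hfin : L.mu 0 b q (Set.Ioi x) + ENNReal.ofReal q * L.R 0 b q Set.univ ≠ ⊤ :=
      ENNReal.add_ne_top.2 ⟨measure_ne_top _ _, ENNReal.mul_ne_top ENNReal.ofReal_ne_top (measure_ne_top _ _)⟩
    refine ((ENNReal.add_right_inj hfin).1 ?_).symm
    rw [add_assoc, h]; ring
  obtain ⟨u, hu1, hu2, hu3⟩ := (Measure.dense_of_ae hB2).exists_seq_strictMono_tendsto x
  have hul : ∀ n, u n < x := fun n => (hu2 n).1
  have hun : ∀ n, L.mu 0 b q (Set.Iic (u n)) = L.nu b q (Set.Iio (u n)) := fun n =>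
    (hu2 n).2 ((hul n).trans_le hx)
  have U1 : Set.Iio x = ⋃ n, Set.Iic (u n) := by
    ext z; simp only [Set.mem_Iio, Set.mem_iUnion, Set.mem_Iic]
    constructor
    · intro hz
      obtain ⟨n, hn⟩ := (hu3.eventually (lt_mem_nhds hz)).exists
      exact ⟨n, hn.le⟩
    · rintro ⟨n, hn⟩; exact hn.trans_lt (hul n)
  have U2 : Set.Iio x = ⋃ n, Set.Iio (u n) := by
    ext z; simp only [Set.mem_Iio, Set.mem_iUnion]
    constructor
    · intro hz
      exact (hu3.eventually (lt_mem_nhds hz)).exists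
    · rintro ⟨n, hn⟩; exact hn.trans (hul n)
  calc L.mu 0 b q (Set.Iio x) = ⨆ n, L.mu 0 b q (Set.Iic (u n)) := by
        rw [U1]
        exact (Monotone.measure_iUnion (fun m n h => Set.Iic_subset_Iic.2 (hu1.monotone h)))
    _ = ⨆ n, L.nu b q (Set.Iio (u n)) := by simp only [hun]
    _ = _ := by
        rw [U2]
        exact (Monotone.measure_iUnion (fun m n h => Set.Iio_subset_Iio (hu1.monotone h))).symm

theorem mu_nu (hBVσ : L.σ2 = 0)
    (hBVPi : ∫⁻ y in Set.Ioo (-1 : ℝ) 0, ENNReal.ofReal (-y) ∂ L.levyMeasure ≠ ⊤)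
    (b q : ℝ) (hb : 0 < b) (hq : 0 ≤ q) :
    (L.mu 0 b q).restrict (Set.Iio 0) = (L.nu b q).restrict (Set.Iio 0) := by
  have := L.mu_finite 0 b q hq
  have h := L.mu_Iio hBVσ hBVPi b q hb hq
  have hfin : IsFiniteMeasure ((L.nu b q).restrict (Set.Iio 0)) := by
    refine ⟨?_⟩
    rw [Measure.restrict_apply_univ, ← h 0 le_rfl]
    exact measure_lt_top _ _
  refine Measure.ext_of_Ici _ _ fun a => ?_
  rw [← Set.compl_Iio, measure_compl measurableSet_Iio (measure_ne_top _ _),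
    measure_compl measurableSet_Iio (measure_ne_top _ _), Measure.restrict_apply_univ,
    Measure.restrict_apply_univ, Measure.restrict_apply measurableSet_Iio,
    Measure.restrict_apply measurableSet_Iio, Set.Iio_inter_Iio, h 0 le_rfl, h _ inf_le_right]

end SNLevy


theorem TV_meas {Ω : Type*} [MeasurableSpace Ω] (X : ℝ → Ω → ℝ) (a b : ℝ)
    (hX : ∀ t, Measurable (X t)) :
    Measurable (fun ω => (TP (fun u => X u ω) a b, XR (fun u => X u ω) (TP (fun u => X u ω) a b))) := by
  have h1 := measurable_TP X a b hX
  have h2 := measurable_XR X hX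
  refine h1.prodMk ?_
  exact Measurable.comp (g := fun p : ℝ × Ω => XR (fun s => X s p.2) p.1)
    (f := fun ω => (TP (fun u => X u ω) a b, ω)) h2 (h1.prodMk measurable_id)

namespace SNLevy

variable {Ω : Type} [MeasurableSpace Ω] (L : SNLevy Ω)

/-- integrand -/
def F (q : ℝ) (p : ℝ × ℝ) : ℝ≥0∞ :=
  ({p : ℝ × ℝ | -p.1 < p.2 ∧ p.2 < 0}).indicator
    (fun p => ENNReal.ofReal (L.W q (p.2 + p.1) / L.W q p.1)) p

theorem F_meas (q : ℝ) (hq : 0 ≤ q) : Measurable (L.F q) := by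
  have hW := L.Wmeas q hq
  refine Measurable.indicator ?_ ?_
  · exact (((hW.comp (measurable_snd.add measurable_fst))).div (hW.comp measurable_fst)).ennreal_ofReal
  · exact (measurableSet_lt measurable_fst.neg measurable_snd).inter
      (measurableSet_lt measurable_snd measurable_const)

theorem indepTV (b : ℝ) (Y : Ω → ℝ)
    (hYX : Indep (MeasurableSpace.comap Y inferInstance)
      (⨆ t : ℝ, MeasurableSpace.comap (L.X t) inferInstance) (L.P 0)) :
    IndepFun Y (fun ω => (L.T 0 b ω, L.V 0 b ω)) (L.P 0) := by
  rw [IndepFun_iff_Indep]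
  refine indep_of_indep_of_le_right hYX ?_
  rw [← measurable_iff_comap_le]
  refine @TV_meas Ω (⨆ t : ℝ, MeasurableSpace.comap (L.X t) inferInstance) L.X 0 b ?_
  intro t
  rw [measurable_iff_comap_le]
  exact le_iSup (fun t : ℝ => MeasurableSpace.comap (L.X t) inferInstance) t

theorem V_ne (hBVσ : L.σ2 = 0)
    (hBVPi : ∫⁻ y in Set.Ioo (-1 : ℝ) 0, ENNReal.ofReal (-y) ∂ L.levyMeasure ≠ ⊤)
    (b q : ℝ) (hb : 0 < b) (hq : 0 ≤ q) : ∀ᵐ ω ∂ L.P 0, L.V 0 b ω ≠ 0 := by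
  have h := L.m_0 hBVσ hBVPi b q hb hq
  have hT := L.T_meas 0 b
  have hV := L.V_meas 0 b
  have hi : Measurable (({0} : Set ℝ).indicator (1 : ℝ → ℝ≥0∞)) :=
    measurable_one.indicator (measurableSet_singleton _)
  have hm : Measurable (fun ω => ENNReal.ofReal (Real.exp (-q * L.T 0 b ω)) *
      ({0} : Set ℝ).indicator (1 : ℝ → ℝ≥0∞) (L.V 0 b ω)) :=
    Measurable.mul (by fun_prop) (hi.comp hV)
  rw [← lintegral_indicator_one (measurableSet_singleton _), L.mu_lintegral 0 b q _ hi,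
    lintegral_eq_zero_iff hm] at h
  filter_upwards [h] with ω hω hV0
  have hω : ENNReal.ofReal (Real.exp (-q * L.T 0 b ω)) *
      ({0} : Set ℝ).indicator (1 : ℝ → ℝ≥0∞) (L.V 0 b ω) = 0 := hω
  rw [Set.indicator_of_mem (by exact hV0)] at hω
  have := Real.exp_pos (-q * L.T 0 b ω)
  rw [Pi.one_apply, mul_one, ENNReal.ofReal_eq_zero] at hω
  linarith

theorem lhs_ae (hBVσ : L.σ2 = 0)
    (hBVPi : ∫⁻ y in Set.Ioo (-1 : ℝ) 0, ENNReal.ofReal (-y) ∂ L.levyMeasure ≠ ⊤)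
    (b q : ℝ) (hb : 0 < b) (hq : 0 ≤ q) (Y : Ω → ℝ) :
    ∀ᵐ ω ∂ L.P 0, (if L.tauBelow 0 ω < L.tauAbove b ω ∧ -(Y ω) < L.X (L.tauBelow 0 ω).toReal ω then
        eNeg q (L.tauBelow 0 ω) *
          (L.W q (L.X (L.tauBelow 0 ω).toReal ω + Y ω) / L.W q (Y ω))
      else 0) = (ENNReal.ofReal (Real.exp (-q * L.T 0 b ω)) * L.F q (Y ω, L.V 0 b ω)).toReal := by
  obtain ⟨l, h0, h1⟩ := L.exists_pos hBVσ hBVPi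
  filter_upwards [L.good, L.EX_ae 0 b l hb.le h0 h1, L.V_ne hBVσ hBVPi b q hb hq] with ω hg hE hV
  have hVe : L.V 0 b ω = L.X (L.T 0 b ω) ω := hg.XR_eq _ (L.T_nonneg _ b ω)
  obtain ⟨k1, k2⟩ := hg.link hb hE (L.tauBelow 0 ω) (L.tauAbove b ω) rfl rfl
  by_cases hlt : L.tauBelow 0 ω < L.tauAbove b ω
  · obtain ⟨j1, j2, j3⟩ := k1 hlt
    have j2 : (L.tauBelow 0 ω).toReal = L.T 0 b ω := j2
    have j3 : L.X (L.T 0 b ω) ω ≤ 0 := j3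
    rw [← hVe] at j3
    have hneg : L.V 0 b ω < 0 := lt_of_le_of_ne j3 hV
    rw [j2, ← hVe]
    by_cases hY : -(Y ω) < L.V 0 b ω
    · have hr : 0 ≤ L.W q (L.V 0 b ω + Y ω) / L.W q (Y ω) :=
        div_nonneg (L.Wnonneg q hq _) (L.Wnonneg q hq _)
      rw [if_pos ⟨hlt, hY⟩, F, Set.indicator_of_mem (by exact ⟨hY, hneg⟩), ENNReal.toReal_mul,
        ENNReal.toReal_ofReal (Real.exp_pos _).le, ENNReal.toReal_ofReal hr, eNeg, if_neg j1, j2]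
    · rw [if_neg (fun h => hY h.2), F, Set.indicator_of_notMem (fun h => hY h.1)]
      simp
  · have k3 : 0 ≤ L.X (L.T 0 b ω) ω := k2 hlt
    rw [← hVe] at k3
    rw [if_neg (fun h => hlt h.1), F, Set.indicator_of_notMem (fun h => absurd k3 (not_le.2 h.2))]
    simp

theorem F_lt (b q : ℝ) (hq : 0 ≤ q) (v : ℝ) :
    ∫⁻ z, L.F q (v, z) ∂ L.mu 0 b q < ⊤ := by
  have := L.mu_finite 0 b q hq
  obtain ⟨C, hC0, hC⟩ := L.W_bdd q hq v
  refine lt_of_le_of_lt (lintegral_mono (g := fun _ => ENNReal.ofReal (C / L.W q v)) ?_) ?_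
  · intro z
    show L.F q (v, z) ≤ ENNReal.ofReal (C / L.W q v)
    unfold F
    by_cases h : (v, z) ∈ {p : ℝ × ℝ | -p.1 < p.2 ∧ p.2 < 0}
    · rw [Set.indicator_of_mem h]
      have h2 : z < 0 := h.2
      have := hC (z + v) (by linarith)
      have n := L.Wnonneg q hq v
      refine ENNReal.ofReal_le_ofReal ?_
      exact div_le_div_of_nonneg_right this n
    · rw [Set.indicator_of_notMem h]; exact zero_le
  · rw [lintegral_const]
    exact ENNReal.mul_lt_top ENNReal.ofReal_lt_top (measure_lt_top _ _)

theorem W_pos (hBVσ : L.σ2 = 0)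
    (hBVPi : ∫⁻ y in Set.Ioo (-1 : ℝ) 0, ENNReal.ofReal (-y) ∂ L.levyMeasure ≠ ⊤)
    (b q : ℝ) (hb : 0 < b) (hq : 0 ≤ q) : 0 < L.W q b := by
  have h := L.m_b hBVσ hBVPi b q hb hq
  have h0 := L.w0_pos hBVσ hBVPi q hq
  by_contra hc
  have : L.w q b = 0 := ENNReal.ofReal_eq_zero.2 (not_lt.1 hc)
  rw [this, mul_zero] at h
  exact h0.ne h

theorem dens_eq (hBVσ : L.σ2 = 0)
    (hBVPi : ∫⁻ y in Set.Ioo (-1 : ℝ) 0, ENNReal.ofReal (-y) ∂ L.levyMeasure ≠ ⊤)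
    (b q : ℝ) (hb : 0 < b) (hq : 0 ≤ q) (y : ℝ) (hy : 0 < y) :
    L.mu 0 b q {b} * L.w q (b - y) = ENNReal.ofReal (L.W q 0 * L.H q b y) ∧ 0 ≤ L.W q 0 * L.H q b y := by
  have hb' := L.W_pos hBVσ hBVPi b q hb hq
  have hm := L.m_b hBVσ hBVPi b q hb hq
  have hH : L.H q b y = L.W q (b - y) / L.W q b := by
    unfold H
    rw [L.Wzero q hq (-y) (by linarith)]; simp
  have e : L.mu 0 b q {b} = ENNReal.ofReal (L.W q 0 / L.W q b) := by
    rw [ENNReal.ofReal_div_of_pos hb', ENNReal.eq_div_iff (ENNReal.ofReal_pos.2 hb').ne'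
      ENNReal.ofReal_ne_top, mul_comm]
    exact hm
  have n1 := L.Wnonneg q hq 0
  have n2 := L.Wnonneg q hq (b - y)
  rw [hH]
  refine ⟨?_, by positivity⟩
  rw [e, w, ← ENNReal.ofReal_mul (by positivity)]
  congr 1; ring

theorem G_eq (hBVσ : L.σ2 = 0)
    (hBVPi : ∫⁻ y in Set.Ioo (-1 : ℝ) 0, ENNReal.ofReal (-y) ∂ L.levyMeasure ≠ ⊤)
    (b q : ℝ) (hb : 0 < b) (hq : 0 ≤ q) (v : ℝ) :
    ∫⁻ z, L.F q (v, z) ∂ L.mu 0 b q = ∫⁻ y in Set.Ioo (0 : ℝ) b, ENNReal.ofReal (L.W q 0 * L.H q b y) *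
      ∫⁻ u, L.F q (v, y + u) ∂ L.levyMeasure := by
  have := L.Pi_sfinite hBVPi
  have hF := L.F_meas q hq
  have hFv : Measurable (fun z => L.F q (v, z)) := hF.comp measurable_prodMk_left
  have hsupp : ∀ m : Measure ℝ, ∫⁻ z, L.F q (v, z) ∂ m = ∫⁻ z in Set.Iio 0, L.F q (v, z) ∂ m := by
    intro m
    rw [← lintegral_indicator measurableSet_Iio]
    refine lintegral_congr fun z => ?_
    by_cases hz : z ∈ Set.Iio (0 : ℝ)
    · rw [Set.indicator_of_mem hz]
    · rw [Set.indicator_of_notMem hz]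
      exact Set.indicator_of_notMem (fun h => hz h.2) _
  have hIm : Measurable (fun y => ∫⁻ u, L.F q (v, y + u) ∂ L.levyMeasure) :=
    Measurable.lintegral_prod_right' (f := fun p : ℝ × ℝ => L.F q (v, p.1 + p.2))
      (hFv.comp (measurable_fst.add measurable_snd))
  have hwm : Measurable (fun x => L.mu 0 b q {b} * L.w q (b - x)) :=
    ((L.w_meas q hq).comp (measurable_const.sub measurable_id)).const_mul _
  rw [hsupp, L.mu_nu hBVσ hBVPi b q hb hq, ← hsupp, L.nu_lintegral hBVPi b q _ hFv,
    L.R_eq hBVσ hBVPi b q hb hq, lintegral_withDensity_eq_lintegral_mul _ hwm hIm]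
  have hU : Set.Ioi (0 : ℝ) = Set.Ioo 0 b ∪ Set.Ici b := (Set.Ioo_union_Ici_eq_Ioi hb).symm
  have hz : ∫⁻ y in Set.Ici b, ((fun x => L.mu 0 b q {b} * L.w q (b - x)) *
      fun y => ∫⁻ u, L.F q (v, y + u) ∂ L.levyMeasure) y = 0 := by
    rw [setLIntegral_congr (Ioi_ae_eq_Ici (a := b)).symm]
    rw [setLIntegral_congr_fun (g := fun _ => 0) measurableSet_Ioi, lintegral_zero]
    intro y hy
    have hy : b < y := hy
    simp only [Pi.mul_apply]
    rw [L.w_neg q hq (b - y) (by linarith)]; simp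
  rw [hU, lintegral_union measurableSet_Ici (by
    rw [Set.disjoint_left]; intro x hx hx'; exact absurd hx.2 (not_lt.2 hx')), hz, add_zero]
  refine setLIntegral_congr_fun measurableSet_Ioo fun y hy => ?_
  simp only [Pi.mul_apply]
  rw [(L.dens_eq hBVσ hBVPi b q hb hq y hy.1).1]

theorem rhs_eq (hBVσ : L.σ2 = 0)
    (hBVPi : ∫⁻ y in Set.Ioo (-1 : ℝ) 0, ENNReal.ofReal (-y) ∂ L.levyMeasure ≠ ⊤)
    (b q : ℝ) (hb : 0 < b) (hq : 0 ≤ q) (v : ℝ) :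
    L.W q 0 * ∫ y in Set.Ioo (0 : ℝ) b, L.H q b y *
          ∫ u in Set.Ioo (-(y + v)) (-y), L.W q (y + u + v) / L.W q v ∂ L.levyMeasure =
      (∫⁻ z, L.F q (v, z) ∂ L.mu 0 b q).toReal := by
  have := L.Pi_sfinite hBVPi
  have hF := L.F_meas q hq
  have hW := L.Wmeas q hq
  have hFv : Measurable (fun z => L.F q (v, z)) := hF.comp measurable_prodMk_left
  have hIm : Measurable (fun y => ∫⁻ u, L.F q (v, y + u) ∂ L.levyMeasure) :=
    Measurable.lintegral_prod_right' (f := fun p : ℝ × ℝ => L.F q (v, p.1 + p.2))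
      (hFv.comp (measurable_fst.add measurable_snd))
  have hfin := L.F_lt b q hq v
  have hin : ∀ y, ∫ u in Set.Ioo (-(y + v)) (-y), L.W q (y + u + v) / L.W q v ∂ L.levyMeasure =
      (∫⁻ u, L.F q (v, y + u) ∂ L.levyMeasure).toReal := by
    intro y
    have hm : Measurable (fun u => L.W q (y + u + v) / L.W q v) :=
      (hW.comp ((measurable_const.add measurable_id).add_const v)).div_const _
    rw [integral_eq_lintegral_of_nonneg_ae (ae_of_all _ fun u =>
      div_nonneg (L.Wnonneg q hq _) (L.Wnonneg q hq _)) hm.aestronglyMeasurable,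
      ← lintegral_indicator measurableSet_Ioo]
    congr 1
    refine lintegral_congr fun u => ?_
    unfold F
    by_cases hu : u ∈ Set.Ioo (-(y + v)) (-y)
    · rw [Set.indicator_of_mem hu, Set.indicator_of_mem (by
        exact ⟨by show -v < y + u; linarith [hu.1], by show y + u < 0; linarith [hu.2]⟩)]
    · rw [Set.indicator_of_notMem hu, Set.indicator_of_notMem (fun h => hu
        ⟨by have : -v < y + u := h.1
            linarith, by
            have : y + u < 0 := h.2
            linarith⟩)]
  simp only [hin]
  rw [L.G_eq hBVσ hBVPi b q hb hq v] at hfin ⊢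
  have hHm : Measurable (fun y => ENNReal.ofReal (L.W q 0 * L.H q b y)) := by
    have : Measurable (fun y => L.H q b y) :=
      ((hW.comp (measurable_const.sub measurable_id)).div_const _).sub
        (((hW.comp measurable_neg).const_mul _).div_const _)
    exact (this.const_mul _).ennreal_ofReal
  have hm : Measurable (fun y => ENNReal.ofReal (L.W q 0 * L.H q b y) *
      ∫⁻ u, L.F q (v, y + u) ∂ L.levyMeasure) := hHm.mul hIm
  rw [← integral_const_mul, ← integral_toReal hm.aemeasurable (ae_lt_top hm hfin.ne)]
  refine setIntegral_congr_fun measurableSet_Ioo fun y hy => ?_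
  show L.W q 0 * (L.H q b y * _) = (ENNReal.ofReal (L.W q 0 * L.H q b y) * _).toReal
  rw [ENNReal.toReal_mul, ENNReal.toReal_ofReal (L.dens_eq hBVσ hBVPi b q hb hq y hy.1).2, mul_assoc]

theorem lhs_prod (b q : ℝ) (hq : 0 ≤ q) (Y : Ω → ℝ) (hYm : Measurable Y)
    (hYX : Indep (MeasurableSpace.comap Y inferInstance)
      (⨆ t : ℝ, MeasurableSpace.comap (L.X t) inferInstance) (L.P 0)) :
    ∫⁻ ω, ENNReal.ofReal (Real.exp (-q * L.T 0 b ω)) * L.F q (Y ω, L.V 0 b ω) ∂ L.P 0 =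
      ∫⁻ ω, ∫⁻ z, L.F q (Y ω, z) ∂ L.mu 0 b q ∂ L.P 0 := by
  have := L.probP 0
  have hF := L.F_meas q hq
  have hTV : Measurable (fun ω => (L.T 0 b ω, L.V 0 b ω)) := (L.T_meas 0 b).prodMk (L.V_meas 0 b)
  have hi := (indepFun_iff_map_prod_eq_prod_map_map hYm.aemeasurable hTV.aemeasurable).1
    (L.indepTV b Y hYX)
  have hΨ : Measurable (fun p : ℝ × (ℝ × ℝ) =>
      ENNReal.ofReal (Real.exp (-q * p.2.1)) * L.F q (p.1, p.2.2)) := by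
    refine Measurable.mul (by fun_prop) (hF.comp (by fun_prop))
  have e1 : ∫⁻ ω, ENNReal.ofReal (Real.exp (-q * L.T 0 b ω)) * L.F q (Y ω, L.V 0 b ω) ∂ L.P 0 =
      ∫⁻ p, ENNReal.ofReal (Real.exp (-q * p.2.1)) * L.F q (p.1, p.2.2)
        ∂ ((L.P 0).map (fun ω => (Y ω, (L.T 0 b ω, L.V 0 b ω)))) :=
    (lintegral_map hΨ (hYm.prodMk hTV)).symm
  have := Measure.isProbabilityMeasure_map (μ := L.P 0) hTV.aemeasurable
  rw [e1, hi, lintegral_prod _ hΨ.aemeasurable, lintegral_map (hΨ.lintegral_prod_right') hYm]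
  refine lintegral_congr fun ω => ?_
  have hm : Measurable (fun z => L.F q (Y ω, z)) := hF.comp measurable_prodMk_left
  rw [L.mu_lintegral 0 b q _ hm]
  exact lintegral_map (hΨ.comp measurable_prodMk_left) hTV

theorem final (hBVσ : L.σ2 = 0)
    (hBVPi : ∫⁻ y in Set.Ioo (-1 : ℝ) 0, ENNReal.ofReal (-y) ∂ L.levyMeasure ≠ ⊤)
    (q : ℝ) (hq : 0 ≤ q) (b : ℝ) (hb : 0 < b)
    (Y : Ω → ℝ) (hYm : Measurable Y)
    (hYX : Indep (MeasurableSpace.comap Y inferInstance)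
      (⨆ t : ℝ, MeasurableSpace.comap (L.X t) inferInstance) (L.P 0)) :
    ∫ ω, (if L.tauBelow 0 ω < L.tauAbove b ω ∧ -(Y ω) < L.X (L.tauBelow 0 ω).toReal ω then
        eNeg q (L.tauBelow 0 ω) *
          (L.W q (L.X (L.tauBelow 0 ω).toReal ω + Y ω) / L.W q (Y ω))
      else 0) ∂ L.P 0
      = L.W q 0 *
        ∫ ω, (∫ y in Set.Ioo (0 : ℝ) b, L.H q b y *
          ∫ u in Set.Ioo (-(y + Y ω)) (-y),
            L.W q (y + u + Y ω) / L.W q (Y ω) ∂ L.levyMeasure) ∂ L.P 0 := by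
  have := L.mu_finite 0 b q hq
  have hF := L.F_meas q hq
  have hT := L.T_meas 0 b
  have hV := L.V_meas 0 b
  have hG : Measurable (fun ω => ∫⁻ z, L.F q (Y ω, z) ∂ L.mu 0 b q) := by
    have : Measurable (fun v => ∫⁻ z, L.F q (v, z) ∂ L.mu 0 b q) := hF.lintegral_prod_right'
    exact this.comp hYm
  rw [← integral_const_mul, integral_congr_ae (L.lhs_ae hBVσ hBVPi b q hb hq Y)]
  simp only [L.rhs_eq hBVσ hBVPi b q hb hq]
  rw [integral_toReal hG.aemeasurable (ae_of_all _ fun ω => L.F_lt b q hq _), integral_toReal,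
    L.lhs_prod b q hq Y hYm hYX]
  · exact (Measurable.mul (by fun_prop) (hF.comp (hYm.prodMk hV))).aemeasurable
  · refine ae_of_all _ fun ω => ENNReal.mul_lt_top ENNReal.ofReal_lt_top ?_
    unfold F
    by_cases h : (Y ω, L.V 0 b ω) ∈ {p : ℝ × ℝ | -p.1 < p.2 ∧ p.2 < 0}
    · rw [Set.indicator_of_mem h]; exact ENNReal.ofReal_lt_top
    · rw [Set.indicator_of_notMem h]; exact ENNReal.zero_lt_top

end SNLevy

/-- `𝔼[e^{-q τ_0^-} 1_{τ_0^- < τ_b^+, X_{τ_0^-} > -Y} W^{(q)}(X_{τ_0^-} + Y)/W^{(q)}(Y)]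
  = W^{(q)}(0+) 𝔼[∫_0^b H^{(q)}(b,y) ∫_{(-y-Y,-y)} W^{(q)}(y+x+Y)/W^{(q)}(Y) Π(dx) dy]`. -/
theorem statement7 {Ω : Type} [MeasurableSpace Ω] (L : SNLevy Ω)
    (hBVσ : L.σ2 = 0)
    (hBVPi : ∫⁻ y in Set.Ioo (-1 : ℝ) 0, ENNReal.ofReal (-y) ∂ L.levyMeasure ≠ ⊤)
    (q : ℝ) (hq : 0 ≤ q) (b : ℝ) (hb : 0 < b)
    (Y : Ω → ℝ) (hYm : Measurable Y) (hY0 : ∀ᵐ ω ∂ L.P 0, 0 ≤ Y ω)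
    (hYX : Indep (MeasurableSpace.comap Y inferInstance)
      (⨆ t : ℝ, MeasurableSpace.comap (L.X t) inferInstance) (L.P 0)) :
    ∫ ω, (if L.tauBelow 0 ω < L.tauAbove b ω ∧ -(Y ω) < L.X (L.tauBelow 0 ω).toReal ω then
        eNeg q (L.tauBelow 0 ω) *
          (L.W q (L.X (L.tauBelow 0 ω).toReal ω + Y ω) / L.W q (Y ω))
      else 0) ∂ L.P 0
      = L.W q 0 *
        ∫ ω, (∫ y in Set.Ioo (0 : ℝ) b, L.H q b y *
          ∫ u in Set.Ioo (-(y + Y ω)) (-y),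
            L.W q (y + u + Y ω) / L.W q (Y ω) ∂ L.levyMeasure) ∂ L.P 0 := by
  exact L.final hBVσ hBVPi q hq b hb Y hYm hYX

end
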